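/- arXiv:2008.09256 — 12 statements merged into one kernel-verified Lean document; each statement's English description precedes it below -/
import Mathlib

section
/- For every ring R and every integer n ≥ 0, the class of finitely n-presented R-modules is closed under extensions: if 0 → A → B → C → 0 is a short exact sequence of R-modules in which A and C are finitely n-presented, then B is finitely n-presented. -/
/-- An `R`-module `M` is finitely `n`-presented if there is an exact sequence
`F_n → F_{n-1} → ⋯ → F_0 → M → 0` of `R`-modules in which every `F_i` is finitely
generated free. (Encoded by an infinite chain of finitely generated free modules which is
required to be exact only at `F_0, …, F_{n-1}` and at `M`.) For `n = 0` this says that `M`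
is finitely generated, for `n = 1` that `M` is finitely presented. -/
def IsFinNPresented (R : Type) [Ring R] (n : ℕ) (M : Type) [AddCommGroup M] [Module R M] :
    Prop :=
  ∃ (k : ℕ → ℕ) (f : ∀ i : ℕ, (Fin (k (i + 1)) → R) →ₗ[R] (Fin (k i) → R))
    (g : (Fin (k 0) → R) →ₗ[R] M),
    Function.Surjective g ∧
    (0 < n → LinearMap.ker g = LinearMap.range (f 0)) ∧
    ∀ i : ℕ, i + 1 < n → LinearMap.ker (f i) = LinearMap.range (f (i + 1))


theorem fnp_zero_of (R : Type) [Ring R] (M : Type) [AddCommGroup M] [Module R M] (m : ℕ)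
    (g : (Fin m → R) →ₗ[R] M) (hg : Function.Surjective g) : IsFinNPresented R 0 M :=
  ⟨fun _ => m, fun _ => 0, g, hg, fun h => absurd h (by omega), fun i h => absurd h (by omega)⟩

theorem fnp_succ_of (R : Type) [Ring R] (n : ℕ) (M : Type) [AddCommGroup M] [Module R M] (m : ℕ)
    (g : (Fin m → R) →ₗ[R] M) (hg : Function.Surjective g)
    (h : IsFinNPresented R n (LinearMap.ker g)) : IsFinNPresented R (n + 1) M := by
  obtain ⟨k, f, g', hg', h0, h1⟩ := h
  let k' : ℕ → ℕ := fun i => Nat.casesOn i m k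
  let f' : ∀ i : ℕ, (Fin (k' (i + 1)) → R) →ₗ[R] (Fin (k' i) → R) := fun i =>
    Nat.casesOn (motive := fun i => (Fin (k' (i + 1)) → R) →ₗ[R] (Fin (k' i) → R)) i
      ((LinearMap.ker g).subtype ∘ₗ g') f
  refine ⟨k', f', g, hg, fun _ => ?_, ?_⟩
  · change LinearMap.ker g = LinearMap.range ((LinearMap.ker g).subtype ∘ₗ g')
    rw [LinearMap.range_comp, LinearMap.range_eq_top.2 hg', Submodule.map_top,
      Submodule.range_subtype]
  · intro i hi
    cases i with
    | zero =>
      change LinearMap.ker ((LinearMap.ker g).subtype ∘ₗ g') = LinearMap.range (f 0)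
      rw [LinearMap.ker_comp_of_ker_eq_bot _ (Submodule.ker_subtype _)]
      exact h0 (by omega)
    | succ i => exact h1 i (by omega)

theorem fnp_succ_elim (R : Type) [Ring R] (n : ℕ) (M : Type) [AddCommGroup M] [Module R M]
    (h : IsFinNPresented R (n + 1) M) : ∃ (m : ℕ) (g : (Fin m → R) →ₗ[R] M),
      Function.Surjective g ∧ IsFinNPresented R n (LinearMap.ker g) := by
  obtain ⟨k, f, g, hg, h0, h1⟩ := h
  have h0 := h0 (by omega)
  refine ⟨k 0, g, hg, fun i => k (i + 1), fun i => f (i + 1),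
    (f 0).codRestrict (LinearMap.ker g) (fun x => h0 ▸ LinearMap.mem_range_self _ x), ?_, ?_, ?_⟩
  · rintro ⟨y, hy⟩
    have hy' := hy
    rw [h0] at hy'
    obtain ⟨x, hx⟩ := hy'
    exact ⟨x, Subtype.ext hx⟩
  · intro hn
    rw [LinearMap.ker_codRestrict]
    exact h1 0 (by omega)
  · intro i hi
    exact h1 (i + 1) (by omega)

theorem fnp_horseshoe (R : Type) [Ring R]
    (A B C : Type) [AddCommGroup A] [Module R A] [AddCommGroup B] [Module R B]
    [AddCommGroup C] [Module R C]
    (f : A →ₗ[R] B) (g : B →ₗ[R] C)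
    (hf : Function.Injective f) (hg : Function.Surjective g)
    (hfg : LinearMap.range f = LinearMap.ker g) (p q : ℕ)
    (a : (Fin p → R) →ₗ[R] A) (c : (Fin q → R) →ₗ[R] C)
    (ha : Function.Surjective a) (hc : Function.Surjective c) :
    ∃ b : (Fin (p + q) → R) →ₗ[R] B, Function.Surjective b ∧
      ∃ (u : LinearMap.ker a →ₗ[R] LinearMap.ker b) (v : LinearMap.ker b →ₗ[R] LinearMap.ker c),
        Function.Injective u ∧ Function.Surjective v ∧ LinearMap.range u = LinearMap.ker v := by
  obtain ⟨d, hd⟩ := Module.projective_lifting_property g c hg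
  have hd' : ∀ y, g (d y) = c y := fun y => LinearMap.congr_fun hd y
  have hgf : ∀ x, g (f x) = 0 := fun x => by
    have : f x ∈ LinearMap.ker g := hfg ▸ LinearMap.mem_range_self f x
    exact this
  have hex : ∀ z, g z = 0 → ∃ x, f (a x) = z := fun z hz => by
    have : z ∈ LinearMap.range f := hfg ▸ hz
    obtain ⟨y, rfl⟩ := this
    obtain ⟨x, rfl⟩ := ha y
    exact ⟨x, rfl⟩
  let e : (Fin (p + q) → R) ≃ₗ[R] (Fin p → R) × (Fin q → R) :=
    (LinearEquiv.funCongrLeft R R finSumFinEquiv).trans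
      (LinearEquiv.sumArrowLequivProdArrow (Fin p) (Fin q) R R)
  clear_value e
  let b : (Fin (p + q) → R) →ₗ[R] B := ((f ∘ₗ a).coprod d) ∘ₗ e.toLinearMap
  have hb : ∀ x, b x = f (a (e x).1) + d (e x).2 := fun x => by simp [b]
  clear_value b
  refine ⟨b, ?_, ?_⟩
  · intro z
    obtain ⟨y, hy⟩ := hc (g z)
    obtain ⟨x, hx⟩ := hex (z - d y) (by simp [hd', hy])
    exact ⟨e.symm (x, y), by simp [hb, hx]⟩
  · refine ⟨(e.symm.toLinearMap ∘ₗ LinearMap.inl R _ _ ∘ₗ (LinearMap.ker a).subtype).codRestrict _ ?_,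
      (LinearMap.snd R _ _ ∘ₗ e.toLinearMap ∘ₗ (LinearMap.ker b).subtype).codRestrict _ ?_,
      ?_, ?_, ?_⟩
    · rintro ⟨x, hx⟩
      have hx' : a x = 0 := hx
      simp [hb, hx']
    · rintro ⟨x, hx⟩
      have hx' : b x = 0 := hx
      rw [hb] at hx'
      have := congrArg g hx'
      simpa [hgf, hd'] using this
    · rintro ⟨x, hx⟩ ⟨y, hy⟩ h
      have h := congrArg (fun w => (e w.1).1) h
      simpa using h
    · rintro ⟨y, hy⟩
      have hy' : c y = 0 := hy
      obtain ⟨x, hx⟩ := hex (d y) (by rw [hd', hy'])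
      exact ⟨⟨e.symm (-x, y), by simp [hb, hx]⟩, Subtype.ext (by simp)⟩
    · ext ⟨w, hw⟩
      have hw' : b w = 0 := hw
      rw [hb] at hw'
      constructor
      · rintro ⟨x, hx⟩
        have h := congrArg (fun w => (e w.1).2) hx
        apply Subtype.ext
        simpa using h.symm
      · intro h
        have h2 : (e w).2 = 0 := congrArg Subtype.val h
        rw [h2, map_zero, add_zero] at hw'
        refine ⟨⟨(e w).1, hf (by rw [hw', map_zero])⟩, Subtype.ext ?_⟩
        apply e.injective
        ext1 <;> simp [h2]

/-- For every ring `R` and every `n ≥ 0`, the class of finitely `n`-presented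
`R`-modules is closed under extensions: if `0 → A → B → C → 0` is a short exact sequence
of `R`-modules in which `A` and `C` are finitely `n`-presented, then so is `B`. -/
theorem finNPresented_closed_under_extensions
    (R : Type) [Ring R] (n : ℕ)
    (A B C : Type) [AddCommGroup A] [Module R A] [AddCommGroup B] [Module R B]
    [AddCommGroup C] [Module R C]
    (f : A →ₗ[R] B) (g : B →ₗ[R] C)
    (hf : Function.Injective f) (hg : Function.Surjective g)
    (hfg : LinearMap.range f = LinearMap.ker g)
    (hA : IsFinNPresented R n A) (hC : IsFinNPresented R n C) :
    IsFinNPresented R n B := by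
  induction n generalizing A B C with
  | zero =>
    obtain ⟨k, _, a, ha, _⟩ := hA
    obtain ⟨l, _, c, hc, _⟩ := hC
    obtain ⟨b, hb, _⟩ := fnp_horseshoe R A B C f g hf hg hfg _ _ a c ha hc
    exact fnp_zero_of R B _ b hb
  | succ n ih =>
    obtain ⟨p, a, ha, hA⟩ := fnp_succ_elim R n A hA
    obtain ⟨q, c, hc, hC⟩ := fnp_succ_elim R n C hC
    obtain ⟨b, hb, u, v, hu, hv, huv⟩ := fnp_horseshoe R A B C f g hf hg hfg _ _ a c ha hc
    exact fnp_succ_of R n B _ b hb (ih _ _ _ u v hu hv huv hA hC)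
end

section
/- Let n ≥ 1 and let R be a strong n-coherent ring. If M is a finitely n-presented R-module and N is a submodule of M that is finitely (n−1)-presented, then N is finitely n-presented. (Equivalently, every finitely n-presented module over a strong n-coherent ring is an n-coherent module.) -/
/-- A ring `R` is strong `n`-coherent if every finitely `n`-presented `R`-module is
finitely `(n+1)`-presented. -/
def StrongNCoherent (R : Type) [Ring R] (n : ℕ) : Prop :=
  ∀ (M : Type) [AddCommGroup M] [Module R M],
    IsFinNPresented R n M → IsFinNPresented R (n + 1) M


theorem finNP_zero {R : Type} [Ring R] {M : Type} [AddCommGroup M] [Module R M] :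
    IsFinNPresented R 0 M ↔ Module.Finite R M := by
  constructor
  · rintro ⟨k, f, g, hg, -, -⟩
    exact Module.Finite.of_surjective g hg
  · intro h
    obtain ⟨k, g, hg⟩ := Module.Finite.exists_fin' R M
    exact ⟨fun _ => k, fun _ => 0, g, hg, by simp, by simp⟩

theorem finNP_succ {R : Type} [Ring R] {n : ℕ} {M : Type} [AddCommGroup M] [Module R M] :
    IsFinNPresented R (n + 1) M ↔ ∃ (k : ℕ) (g : (Fin k → R) →ₗ[R] M),
      Function.Surjective g ∧ IsFinNPresented R n (LinearMap.ker g) := by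
  constructor
  · rintro ⟨k, f, g, hg, h0, hs⟩
    have h0 := h0 (Nat.succ_pos n)
    have hmem : ∀ x, f 0 x ∈ LinearMap.ker g := fun x => by
      rw [h0]; exact LinearMap.mem_range_self _ _
    refine ⟨k 0, g, hg, fun i => k (i + 1), fun i => f (i + 1),
      (f 0).codRestrict (LinearMap.ker g) hmem, ?_, ?_, ?_⟩
    · rintro ⟨y, hy⟩
      have hy' := hy
      rw [h0] at hy'
      obtain ⟨x, hx⟩ := hy'
      exact ⟨x, Subtype.ext hx⟩
    · intro hn
      rw [LinearMap.ker_codRestrict]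
      exact hs 0 (by omega)
    · intro i hi
      exact hs (i + 1) (by omega)
  · rintro ⟨k0, g0, hg0, k, f, g, hg, h0, hs⟩
    let k' : ℕ → ℕ := fun i => Nat.rec k0 (fun j _ => k j) i
    let f' : ∀ i : ℕ, (Fin (k' (i + 1)) → R) →ₗ[R] (Fin (k' i) → R) := fun i =>
      match i with
      | 0 => (LinearMap.ker g0).subtype ∘ₗ g
      | j + 1 => f j
    refine ⟨k', f', g0, hg0, ?_, ?_⟩
    · intro _
      change LinearMap.ker g0 = LinearMap.range ((LinearMap.ker g0).subtype ∘ₗ g)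
      rw [LinearMap.range_comp, LinearMap.range_eq_top.2 hg, Submodule.map_top,
        Submodule.range_subtype]
    · intro i hi
      cases i with
      | zero =>
        change LinearMap.ker ((LinearMap.ker g0).subtype ∘ₗ g) = LinearMap.range (f 0)
        rw [LinearMap.ker_comp_of_ker_eq_bot _ (Submodule.ker_subtype _)]
        exact h0 (by omega)
      | succ j => exact hs j (by omega)

theorem finNP_free {R : Type} [Ring R] (n k : ℕ) : IsFinNPresented R n (Fin k → R) := by
  have hz : ∀ (n : ℕ) (M : Type) [AddCommGroup M] [Module R M] [Subsingleton M],
      IsFinNPresented R n M := by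
    intro n
    induction n with
    | zero => intro M _ _ _; exact finNP_zero.2 inferInstance
    | succ n ih =>
      intro M _ _ _
      exact finNP_succ.2 ⟨0, 0, fun x => ⟨0, Subsingleton.elim _ _⟩, ih _⟩
  cases n with
  | zero => exact finNP_zero.2 inferInstance
  | succ n =>
    refine finNP_succ.2 ⟨k, LinearMap.id, fun x => ⟨x, rfl⟩, ?_⟩
    haveI : Subsingleton (LinearMap.ker (LinearMap.id : (Fin k → R) →ₗ[R] (Fin k → R))) := by
      rw [LinearMap.ker_id]; infer_instance
    exact hz n _

/-- surjection from a sum of free modules may be used in place of a standard free module -/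
theorem finNP_succ_prod {R : Type} [Ring R] {n : ℕ} {M : Type} [AddCommGroup M] [Module R M]
    (a c : ℕ) (h : ((Fin a → R) × (Fin c → R)) →ₗ[R] M) (hh : Function.Surjective h)
    (H : ∀ (m : ℕ) (e : (Fin m → R) ≃ₗ[R] ((Fin a → R) × (Fin c → R))),
      IsFinNPresented R n (LinearMap.ker (h ∘ₗ e.toLinearMap))) :
    IsFinNPresented R (n + 1) M := by
  let e : (Fin (a + c) → R) ≃ₗ[R] ((Fin a → R) × (Fin c → R)) :=
    (LinearEquiv.funCongrLeft R R finSumFinEquiv).trans (LinearEquiv.sumArrowLequivProdArrow _ _ R R)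
  exact finNP_succ.2 ⟨a + c, h ∘ₗ e.toLinearMap, hh.comp e.surjective, H _ e⟩

theorem finNP_ext {R : Type} [Ring R] (n : ℕ) : ∀ (A B C : Type) [AddCommGroup A] [Module R A]
    [AddCommGroup B] [Module R B] [AddCommGroup C] [Module R C]
    (i : A →ₗ[R] B) (q : B →ₗ[R] C), Function.Injective i → Function.Surjective q →
    (∀ b, q b = 0 ↔ ∃ a, i a = b) → IsFinNPresented R n A → IsFinNPresented R n C →
    IsFinNPresented R n B := by
  induction n with
  | zero =>
    intro A B C _ _ _ _ _ _ i q hi hq hex hA hC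
    rw [finNP_zero] at *
    have hk : LinearMap.ker q = LinearMap.range i := by ext b; simp [hex]
    refine ⟨Submodule.fg_of_fg_map_of_fg_inf_ker q ?_ ?_⟩
    · rw [Submodule.map_top, LinearMap.range_eq_top.2 hq]; exact hC.1
    · rw [top_inf_eq, hk, LinearMap.range_eq_map]; exact hA.1.map i
  | succ n ih =>
    intro A B C _ _ _ _ _ _ i q hi hq hex hA hC
    obtain ⟨a, g, hg, hgk⟩ := finNP_succ.1 hA
    obtain ⟨c, p, hp, hpk⟩ := finNP_succ.1 hC
    obtain ⟨s, hs⟩ := Module.projective_lifting_property q p hq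
    have hs' : ∀ x, q (s x) = p x := fun x => LinearMap.congr_fun hs x
    have hqi : ∀ x, q (i x) = 0 := fun x => (hex _).2 ⟨x, rfl⟩
    refine finNP_succ_prod a c ((i ∘ₗ g).coprod s) ?_ ?_
    · intro b
      obtain ⟨y, hy⟩ := hp (q b)
      obtain ⟨x, hx⟩ := (hex (b - s y)).1 (by simp [hs', hy])
      obtain ⟨z, rfl⟩ := hg x
      exact ⟨(z, y), by simp [hx]⟩
    · intro m e
      refine ih (LinearMap.ker g) _ (LinearMap.ker p)
        (LinearMap.restrict (e.symm.toLinearMap ∘ₗ LinearMap.inl R _ _) ?_)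
        (LinearMap.restrict (LinearMap.snd R _ _ ∘ₗ e.toLinearMap) ?_) ?_ ?_ ?_ hgk hpk
      · intro x hx
        rw [LinearMap.mem_ker] at hx
        simp [hx]
      · intro x hx
        have := congrArg q (LinearMap.mem_ker.1 hx)
        simpa [hs', hqi] using this
      · intro x y hxy
        have h1 : e.symm (x.1, 0) = e.symm (y.1, 0) := congrArg Subtype.val hxy
        exact Subtype.ext (congrArg Prod.fst (e.symm.injective h1))
      · rintro ⟨y, hy⟩
        obtain ⟨x, hx⟩ := (hex (s y)).1 (by rw [hs']; exact hy)
        obtain ⟨z, rfl⟩ := hg x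
        exact ⟨⟨e.symm (-z, y), by simp [hx]⟩, Subtype.ext (by simp)⟩
      · rintro ⟨x, hx⟩
        constructor
        · intro h
          have h2 : (e x).2 = 0 := congrArg Subtype.val h
          have h1 : g (e x).1 = 0 := hi (by simpa [h2] using hx)
          refine ⟨⟨(e x).1, h1⟩, Subtype.ext ?_⟩
          change e.symm ((e x).1, 0) = x
          rw [← h2]; simp
        · rintro ⟨y, hy⟩
          have := congrArg Subtype.val hy
          change e.symm (y.1, 0) = x at this
          refine Subtype.ext ?_
          change (e x).2 = 0
          rw [← this]; simp

theorem finNP_quot {R : Type} [Ring R] (n : ℕ) (A B C : Type) [AddCommGroup A] [Module R A]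
    [AddCommGroup B] [Module R B] [AddCommGroup C] [Module R C]
    (i : A →ₗ[R] B) (q : B →ₗ[R] C) (hi : Function.Injective i) (hq : Function.Surjective q)
    (hex : ∀ b, q b = 0 ↔ ∃ a, i a = b) (hA : IsFinNPresented R (n - 1) A)
    (hB : IsFinNPresented R n B) : IsFinNPresented R n C := by
  cases n with
  | zero =>
    rw [finNP_zero] at *
    exact Module.Finite.of_surjective q hq
  | succ n =>
    obtain ⟨k, g, hg, hgk⟩ := finNP_succ.1 hB
    refine finNP_succ.2 ⟨k, q ∘ₗ g, hq.comp hg, ?_⟩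
    let j : A ≃ₗ[R] LinearMap.range i := LinearEquiv.ofInjective i hi
    have hr : ∀ x ∈ LinearMap.ker (q ∘ₗ g), g x ∈ LinearMap.range i := fun x hx =>
      (hex _).1 hx
    refine finNP_ext n (LinearMap.ker g) _ A
      (Submodule.inclusion (fun x hx => by
        rw [LinearMap.mem_ker] at hx; simp [hx]))
      (j.symm.toLinearMap ∘ₗ LinearMap.restrict g hr) (Submodule.inclusion_injective _)
      ?_ ?_ hgk hA
    · refine j.symm.surjective.comp ?_
      rintro ⟨y, hy⟩
      obtain ⟨x, rfl⟩ := hg y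
      exact ⟨⟨x, (hex _).2 hy⟩, Subtype.ext rfl⟩
    · rintro ⟨x, hx⟩
      constructor
      · intro h
        have h' : LinearMap.restrict g hr ⟨x, hx⟩ = 0 := by simpa using h
        have h2 : g x = 0 := congrArg Subtype.val h'
        exact ⟨⟨x, h2⟩, rfl⟩
      · rintro ⟨y, hy⟩
        have h1 : y.1 = x := congrArg Subtype.val hy
        have h2 : LinearMap.restrict g hr ⟨x, hx⟩ = 0 := Subtype.ext (by
          change g x = 0
          rw [← h1]; exact y.2)
        simp [h2]

theorem finNP_sub {R : Type} [Ring R] (n : ℕ) (A B C : Type) [AddCommGroup A] [Module R A]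
    [AddCommGroup B] [Module R B] [AddCommGroup C] [Module R C]
    (i : A →ₗ[R] B) (q : B →ₗ[R] C) (hi : Function.Injective i) (hq : Function.Surjective q)
    (hex : ∀ b, q b = 0 ↔ ∃ a, i a = b) (hB : IsFinNPresented R n B)
    (hC : IsFinNPresented R (n + 1) C) : IsFinNPresented R n A := by
  obtain ⟨k, g, hg, hgk⟩ := finNP_succ.1 hC
  obtain ⟨s, hs⟩ := Module.projective_lifting_property q g hq
  have hs' : ∀ x, q (s x) = g x := fun x => LinearMap.congr_fun hs x
  have hqi : ∀ x, q (i x) = 0 := fun x => (hex _).2 ⟨x, rfl⟩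
  let j : A ≃ₗ[R] LinearMap.range i := LinearEquiv.ofInjective i hi
  have hj : ∀ y, i (j.symm y) = y := fun y => congrArg Subtype.val (j.apply_symm_apply y)
  have hr : ∀ x ∈ LinearMap.ker g, s x ∈ LinearMap.range i := fun x hx =>
    (hex _).1 (by rw [hs']; exact hx)
  have hX : IsFinNPresented R n (A × (Fin k → R)) := by
    refine finNP_ext n (LinearMap.ker g) _ B
      (LinearMap.prod (-(j.symm.toLinearMap ∘ₗ LinearMap.restrict s hr))
        (LinearMap.ker g).subtype) (i.coprod s) ?_ ?_ ?_ hgk hB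
    · intro x y hxy
      exact Subtype.ext (congrArg Prod.snd hxy)
    · intro b
      obtain ⟨y, hy⟩ := hg (q b)
      obtain ⟨x, hx⟩ := (hex (b - s y)).1 (by simp [hs', hy])
      exact ⟨(x, y), by simp [hx]⟩
    · rintro ⟨x, y⟩
      constructor
      · intro h
        have h : i x + s y = 0 := by simpa using h
        have hy : g y = 0 := by simpa [hs', hqi] using congrArg q h
        refine ⟨⟨y, hy⟩, Prod.ext (hi ?_) rfl⟩
        change i (-(j.symm (LinearMap.restrict s hr ⟨y, hy⟩))) = i x
        rw [map_neg, hj]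
        exact (eq_neg_of_add_eq_zero_left h).symm
      · rintro ⟨z, hz⟩
        rw [← hz]
        change i (-(j.symm (LinearMap.restrict s hr z))) + s z.1 = 0
        rw [map_neg, hj]
        exact neg_add_cancel _
  refine finNP_quot n (Fin k → R) _ A (LinearMap.inr R A _) (LinearMap.fst R A _)
    LinearMap.inr_injective LinearMap.fst_surjective ?_ (finNP_free _ _) hX
  rintro ⟨x, y⟩
  simp [eq_comm]

/-- Let `n ≥ 1` and let `R` be a strong `n`-coherent ring. If `M` is a
finitely `n`-presented `R`-module and `N` is a submodule of `M` which is finitely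
`(n-1)`-presented, then `N` is finitely `n`-presented (i.e. every finitely `n`-presented
module over a strong `n`-coherent ring is an `n`-coherent module). -/
theorem finNPresented_is_nCoherent
    (R : Type) [Ring R] (n : ℕ) (hn : 1 ≤ n) (hR : StrongNCoherent R n)
    (M : Type) [AddCommGroup M] [Module R M] (hM : IsFinNPresented R n M)
    (N : Submodule R M) (hN : IsFinNPresented R (n - 1) N) :
    IsFinNPresented R n N := by
  have hex : ∀ b, N.mkQ b = 0 ↔ ∃ a, N.subtype a = b := by
    intro b; simp
  exact finNP_sub n N M (M ⧸ N) N.subtype N.mkQ N.injective_subtype N.mkQ_surjective hex hM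
    (hR _ (finNP_quot n N M (M ⧸ N) N.subtype N.mkQ N.injective_subtype N.mkQ_surjective hex
      hN hM))
end

section
/- Let n ≥ 1. A ring R is strong n-coherent if and only if the class of finitely n-presented R-modules is closed under taking kernels of epimorphisms: for every surjective R-linear map f : B → C with B and C finitely n-presented, the kernel of f is finitely n-presented. -/
section helpers
variable {R : Type} [Ring R]
  {A B C M N K Q : Type} [AddCommGroup A] [Module R A] [AddCommGroup B] [Module R B]
  [AddCommGroup C] [Module R C] [AddCommGroup M] [Module R M] [AddCommGroup N] [Module R N]
  [AddCommGroup K] [Module R K] [AddCommGroup Q] [Module R Q]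

theorem fnp_zero : IsFinNPresented R 0 M ↔ Module.Finite R M := by
  constructor
  · rintro ⟨k, f, g, hg, -⟩
    exact Module.Finite.of_surjective g hg
  · intro h
    obtain ⟨k, g, hg⟩ := Module.Finite.exists_fin' R M
    exact ⟨fun _ => k, fun _ => 0, g, hg, by simp, by simp⟩

theorem fnp_succ {n : ℕ} : IsFinNPresented R (n + 1) M ↔
    ∃ (k : ℕ) (g : (Fin k → R) →ₗ[R] M), Function.Surjective g ∧
      IsFinNPresented R n (LinearMap.ker g) := by
  constructor
  · rintro ⟨k, f, g, hg, h0, h1⟩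
    have h0' := h0 (by omega)
    have hm : ∀ x, f 0 x ∈ LinearMap.ker g := fun x => by rw [h0']; exact ⟨x, rfl⟩
    refine ⟨k 0, g, hg, fun i => k (i + 1), fun i => f (i + 1),
      LinearMap.codRestrict _ (f 0) hm, ?_, ?_, ?_⟩
    · rintro ⟨y, hy⟩
      have hy' := hy
      rw [h0'] at hy'
      obtain ⟨x, hx⟩ := hy'
      exact ⟨x, Subtype.ext hx⟩
    · intro h
      rw [LinearMap.ker_codRestrict]
      exact h1 0 (by omega)
    · intro i hi
      exact h1 (i + 1) (by omega)
  · rintro ⟨k0, g, hg, k, f, g', hg', h0, h1⟩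
    let k' : ℕ → ℕ := fun i => Nat.casesOn i k0 k
    let f' : ∀ i : ℕ, (Fin (k' (i + 1)) → R) →ₗ[R] (Fin (k' i) → R) := fun i =>
      match i with
      | 0 => (LinearMap.ker g).subtype ∘ₗ g'
      | i + 1 => f i
    refine ⟨k', f', g, hg, ?_, ?_⟩
    · intro _
      change _ = LinearMap.range ((LinearMap.ker g).subtype ∘ₗ g')
      rw [LinearMap.range_comp, LinearMap.range_eq_top.2 hg', Submodule.map_top,
        Submodule.range_subtype]
    · intro i hi
      match i with
      | 0 =>
        change LinearMap.ker ((LinearMap.ker g).subtype ∘ₗ g') = LinearMap.range (f 0)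
        rw [LinearMap.ker_comp, Submodule.ker_subtype, ← h0 (by omega)]
        rfl
      | i + 1 => exact h1 i (by omega)

theorem fnp_equiv {n : ℕ} (e : M ≃ₗ[R] N) (h : IsFinNPresented R n M) :
    IsFinNPresented R n N := by
  obtain ⟨k, f, g, hg, h0, h1⟩ := h
  refine ⟨k, f, e.toLinearMap ∘ₗ g, e.surjective.comp hg, ?_, h1⟩
  intro h
  rw [LinearEquiv.ker_comp, h0 h]

theorem fnp_subsingleton [Subsingleton M] (n : ℕ) : IsFinNPresented R n M :=
  ⟨fun _ => 0, fun _ => 0, 0, fun x => ⟨0, Subsingleton.elim _ _⟩,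
    fun _ => by ext x; simp [Subsingleton.elim x 0],
    fun _ _ => by ext x; simp [Subsingleton.elim x 0]⟩

theorem fnp_free (n k : ℕ) : IsFinNPresented R n (Fin k → R) := by
  cases n with
  | zero => rw [fnp_zero]; infer_instance
  | succ n =>
    rw [fnp_succ]
    refine ⟨k, LinearMap.id, Function.surjective_id, ?_⟩
    rw [LinearMap.ker_id]
    exact fnp_subsingleton n

theorem fnp_mk {n k : ℕ} (e : (Fin k → R) ≃ₗ[R] Q) (h : Q →ₗ[R] M)
    (hh : Function.Surjective h) (hK : IsFinNPresented R n (LinearMap.ker h)) :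
    IsFinNPresented R (n + 1) M := by
  rw [fnp_succ]
  refine ⟨k, h ∘ₗ e.toLinearMap, hh.comp e.surjective, fnp_equiv ?_ hK⟩
  refine (e.symm.submoduleMap (LinearMap.ker h)).trans (LinearEquiv.ofEq _ _ ?_)
  ext x
  simp

theorem fnp_mono {n : ℕ} : ∀ {M : Type} [AddCommGroup M] [Module R M],
    IsFinNPresented R (n + 1) M → IsFinNPresented R n M := by
  rintro M _ _ ⟨k, f, g, hg, h0, h1⟩
  exact ⟨k, f, g, hg, fun _ => h0 (by omega), fun i hi => h1 i (by omega)⟩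

theorem fnp_ext (n : ℕ) : ∀ {A B C : Type} [AddCommGroup A] [Module R A] [AddCommGroup B]
    [Module R B] [AddCommGroup C] [Module R C] (f : A →ₗ[R] B) (p : B →ₗ[R] C),
    Function.Injective f → Function.Surjective p → Function.Exact f p →
    IsFinNPresented R n A → IsFinNPresented R n C → IsFinNPresented R n B := by
  induction n with
  | zero =>
    intro A B C _ _ _ _ _ _ f p hf hp hfp hA hC
    rw [fnp_zero] at *
    exact Module.Finite.of_exact hfp hp
  | succ n ih =>
    intro A B C _ _ _ _ _ _ f p hf hp hfp hA hC
    obtain ⟨a, gA, hgA, hKA⟩ := fnp_succ.1 hA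
    obtain ⟨c, gC, hgC, hKC⟩ := fnp_succ.1 hC
    obtain ⟨l, hl⟩ := Module.projective_lifting_property p gC hp
    have hl' : ∀ y, p (l y) = gC y := fun y => LinearMap.congr_fun hl y
    have hpf : ∀ x, p (f x) = 0 := fun x => (hfp (f x)).2 ⟨x, rfl⟩
    let e : (Fin (a + c) → R) ≃ₗ[R] (Fin a → R) × (Fin c → R) :=
      (LinearEquiv.funCongrLeft R R finSumFinEquiv).trans
        (LinearEquiv.sumArrowLequivProdArrow (Fin a) (Fin c) R R)
    let h : (Fin a → R) × (Fin c → R) →ₗ[R] B := (f ∘ₗ gA).coprod l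
    have hdef : ∀ x y, h (x, y) = f (gA x) + l y := fun x y => by simp [h]
    have key : ∀ y, gC y = 0 → ∃ x, h (x, y) = 0 := by
      intro y hy
      obtain ⟨z, hz⟩ := (hfp (l y)).1 (by rw [hl', hy])
      obtain ⟨x, rfl⟩ := hgA z
      exact ⟨-x, by rw [hdef, map_neg, map_neg, hz]; simp⟩
    refine fnp_mk e h ?_ ?_
    · intro b
      obtain ⟨y, hy⟩ := hgC (p b)
      obtain ⟨z, hz⟩ := (hfp (b - l y)).1 (by rw [map_sub, hl', hy, sub_self])
      obtain ⟨x, rfl⟩ := hgA z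
      exact ⟨(x, y), by rw [hdef, hz]; abel⟩
    · let i : LinearMap.ker gA →ₗ[R] LinearMap.ker h :=
        (LinearMap.inl R _ _).restrict (fun x hx => by
          have hx' : gA x = 0 := hx
          change h (x, 0) = 0
          rw [hdef, hx']; simp)
      let q : LinearMap.ker h →ₗ[R] LinearMap.ker gC :=
        (LinearMap.snd R _ _).restrict (fun x hx => by
          obtain ⟨x, y⟩ := x
          have hx' : h (x, y) = 0 := hx
          have := congrArg p hx'
          rw [hdef, map_add, hpf, hl'] at this
          change gC y = 0
          simpa using this)
      refine ih i q ?_ ?_ ?_ hKA hKC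
      · rintro ⟨x, hx⟩ ⟨y, hy⟩ hxy
        have := congrArg (fun t => t.1.1) hxy
        exact Subtype.ext this
      · rintro ⟨y, hy⟩
        obtain ⟨x, hx⟩ := key y hy
        exact ⟨⟨(x, y), hx⟩, rfl⟩
      · rintro ⟨⟨x, y⟩, hxy⟩
        constructor
        · intro hq
          have hy : y = 0 := congrArg Subtype.val hq
          subst hy
          have hx' : h (x, 0) = 0 := hxy
          rw [hdef, map_zero, add_zero] at hx'
          have : gA x = 0 := hf (by rw [hx', map_zero])
          exact ⟨⟨x, this⟩, rfl⟩
        · rintro ⟨⟨z, hz⟩, hzz⟩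
          have : (0 : Fin c → R) = y := congrArg (fun t => t.1.2) hzz
          exact Subtype.ext this.symm

theorem fnp_quot {n : ℕ} (p : B →ₗ[R] C) (hp : Function.Surjective p)
    (hA : IsFinNPresented R n (LinearMap.ker p)) (hB : IsFinNPresented R (n + 1) B) :
    IsFinNPresented R (n + 1) C := by
  obtain ⟨k, g, hg, hK⟩ := fnp_succ.1 hB
  refine fnp_succ.2 ⟨k, p ∘ₗ g, hp.comp hg, ?_⟩
  let i : LinearMap.ker g →ₗ[R] LinearMap.ker (p ∘ₗ g) :=
    Submodule.inclusion (LinearMap.ker_le_ker_comp g p)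
  let q : LinearMap.ker (p ∘ₗ g) →ₗ[R] LinearMap.ker p := g.restrict (fun x hx => hx)
  refine fnp_ext n i q (Submodule.inclusion_injective _) ?_ ?_ hK hA
  · rintro ⟨y, hy⟩
    obtain ⟨x, rfl⟩ := hg y
    exact ⟨⟨x, hy⟩, rfl⟩
  · rintro ⟨x, hx⟩
    constructor
    · intro h
      exact ⟨⟨x, congrArg Subtype.val h⟩, rfl⟩
    · rintro ⟨⟨z, hz⟩, hzz⟩
      have : z = x := congrArg Subtype.val hzz
      subst this
      exact Subtype.ext hz

theorem fnp_ker {n : ℕ} (p : B →ₗ[R] C) (hp : Function.Surjective p)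
    (hB : IsFinNPresented R n B) (hC : IsFinNPresented R (n + 1) C) :
    IsFinNPresented R n (LinearMap.ker p) := by
  obtain ⟨k, g, hg, hK⟩ := fnp_succ.1 hC
  obtain ⟨l, hl⟩ := Module.projective_lifting_property p g hp
  have hl' : ∀ y, p (l y) = g y := fun y => LinearMap.congr_fun hl y
  -- the pullback is `ker p × R^k`, mapping onto `B` with kernel `ker g`
  let h : (LinearMap.ker p × (Fin k → R)) →ₗ[R] B := (LinearMap.ker p).subtype.coprod l
  let i : LinearMap.ker g →ₗ[R] LinearMap.ker p × (Fin k → R) :=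
    (LinearMap.codRestrict (LinearMap.ker p) (-(l ∘ₗ (LinearMap.ker g).subtype))
      (fun x => by
        have hx : g x.1 = 0 := x.2
        simp [hl', hx])).prod (LinearMap.ker g).subtype
  have hP : IsFinNPresented R n (LinearMap.ker p × (Fin k → R)) := by
    refine fnp_ext n i h ?_ ?_ ?_ hK hB
    · intro x y hxy
      exact Subtype.ext (congrArg Prod.snd hxy)
    · intro b
      obtain ⟨y, hy⟩ := hg (p b)
      exact ⟨(⟨b - l y, by simp [hl', hy]⟩, y), by simp [h]⟩
    · rintro ⟨⟨x, hx⟩, y⟩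
      constructor
      · intro hh
        have hh' : x + l y = 0 := by simpa [h] using hh
        have hx' : p x = 0 := hx
        have hy : g y = 0 := by
          have := congrArg p hh'
          rw [map_add, hx', hl'] at this
          simpa using this
        refine ⟨⟨y, hy⟩, Prod.ext (Subtype.ext ?_) rfl⟩
        change -(l y) = x
        exact (eq_neg_of_add_eq_zero_left hh').symm
      · rintro ⟨z, hz⟩
        rw [← hz]
        change -(l z.1) + l z.1 = 0
        simp
  cases n with
  | zero =>
    rw [fnp_zero] at *
    exact Module.Finite.of_surjective (LinearMap.fst R (LinearMap.ker p) (Fin k → R)) LinearMap.fst_surjective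
  | succ n =>
    refine fnp_quot (LinearMap.fst R (LinearMap.ker p) (Fin k → R)) LinearMap.fst_surjective ?_ hP
    rw [LinearMap.ker_fst]
    exact fnp_equiv (LinearEquiv.ofInjective _ LinearMap.inr_injective) (fnp_free n k)

end helpers

/-- For `n ≥ 1`, a ring `R` is strong `n`-coherent if and only if the class
of finitely `n`-presented `R`-modules is closed under taking kernels of epimorphisms. -/
theorem strongNCoherent_iff_ker_of_epi
    (R : Type) [Ring R] (n : ℕ) (hn : 1 ≤ n) :
    StrongNCoherent R n ↔
      ∀ (B C : Type) [AddCommGroup B] [Module R B] [AddCommGroup C] [Module R C]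
        (f : B →ₗ[R] C), Function.Surjective f →
        IsFinNPresented R n B → IsFinNPresented R n C →
        IsFinNPresented R n (LinearMap.ker f) := by
  constructor
  · intro h B C _ _ _ _ f hf hB hC
    exact fnp_ker f hf hB (h C hC)
  · intro h M _ _ hM
    obtain ⟨k, _, g, hg, -⟩ := id hM
    exact fnp_succ.2 ⟨_, g, hg, h _ _ g hg (fnp_free n _) hM⟩
end

section
/- Let n ≥ 1 and let R be a strong n-coherent ring. Then the class of finitely n-presented R-modules is thick: it is closed under direct summands, and for every short exact sequence 0 → A → B → C → 0 of R-modules in which two of the three modules A, B, C are finitely n-presented, the third one is also finitely n-presented. In particular it is closed under extensions, under cokernels of monomorphisms, and under kernels of epimorphisms. -/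
def FP (R : Type) [Ring R] : ℕ → ∀ (M : Type) [AddCommGroup M] [Module R M], Prop
  | 0, M, _, _ => Module.Finite R M
  | n + 1, M, _, _ => ∃ (k : ℕ) (g : (Fin k → R) →ₗ[R] M),
      Function.Surjective g ∧ FP R n (LinearMap.ker g)

section FPsec

variable {R : Type} [Ring R]

theorem isFin_to_FP (n : ℕ) : ∀ (M : Type) [AddCommGroup M] [Module R M],
    IsFinNPresented R n M → FP R n M := by
  induction n with
  | zero =>
    rintro M _ _ ⟨k, f, g, hg, -, -⟩
    exact Module.Finite.of_surjective g hg
  | succ n ih =>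
    rintro M _ _ ⟨k, f, g, hg, h0, hi⟩
    have h0 := h0 (Nat.succ_pos n)
    have hmem : ∀ x, f 0 x ∈ LinearMap.ker g := fun x => by rw [h0]; exact ⟨x, rfl⟩
    refine ⟨k 0, g, hg, ih _ ⟨fun i => k (i + 1), fun i => f (i + 1),
      (f 0).codRestrict _ hmem, ?_, ?_, ?_⟩⟩
    · rintro ⟨y, hy⟩
      rw [h0] at hy
      obtain ⟨x, rfl⟩ := hy
      exact ⟨x, rfl⟩
    · intro hn
      rw [LinearMap.ker_codRestrict]
      exact hi 0 (by omega)
    · intro i hin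
      exact hi (i + 1) (by omega)

theorem FP_to_isFin (n : ℕ) : ∀ (M : Type) [AddCommGroup M] [Module R M],
    FP R n M → IsFinNPresented R n M := by
  induction n with
  | zero =>
    intro M _ _ h
    have : Module.Finite R M := h
    obtain ⟨k, g, hg⟩ := Module.Finite.exists_fin' R M
    exact ⟨fun _ => k, fun _ => 0, g, hg, fun h => absurd h (by omega),
      fun i h => absurd h (by omega)⟩
  | succ n ih =>
    rintro M _ _ ⟨k0, g, hg, hk⟩
    obtain ⟨k, f, g', hg', h0, hi⟩ := ih _ hk
    refine ⟨fun i => match i with | 0 => k0 | j + 1 => k j,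
      fun i => match i with | 0 => (LinearMap.ker g).subtype ∘ₗ g' | j + 1 => f j,
      g, hg, ?_, ?_⟩
    · intro _
      show LinearMap.ker g = LinearMap.range ((LinearMap.ker g).subtype ∘ₗ g')
      rw [LinearMap.range_comp, LinearMap.range_eq_top.2 hg']
      simp
    · rintro (_ | i) h
      · show LinearMap.ker ((LinearMap.ker g).subtype ∘ₗ g') = LinearMap.range (f 0)
        rw [LinearMap.ker_comp_of_ker_eq_bot _ (Submodule.ker_subtype _)]
        exact h0 (by omega)
      · exact hi i (by omega)

theorem FP.equiv {n : ℕ} {M N : Type} [AddCommGroup M] [Module R M] [AddCommGroup N] [Module R N]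
    (e : M ≃ₗ[R] N) (h : FP R n M) : FP R n N := by
  cases n with
  | zero =>
    have : Module.Finite R M := h
    exact Module.Finite.equiv e
  | succ n =>
    obtain ⟨k, g, hg, hk⟩ := h
    refine ⟨k, e.toLinearMap ∘ₗ g, e.surjective.comp hg, ?_⟩
    rw [LinearMap.ker_comp_of_ker_eq_bot _ e.ker]
    exact hk

theorem FP.succ_of {n k : ℕ} {F M : Type} [AddCommGroup M] [Module R M] [AddCommGroup F]
    [Module R F] (e : (Fin k → R) ≃ₗ[R] F) (g : F →ₗ[R] M) (hg : Function.Surjective g)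
    (h : FP R n (LinearMap.ker g)) : FP R (n + 1) M := by
  refine ⟨k, g ∘ₗ e.toLinearMap, hg.comp e.surjective, FP.equiv ?_ h⟩
  refine (LinearEquiv.ofSubmodules e _ _ ?_).symm
  ext x
  constructor
  · rintro ⟨y, hy, rfl⟩
    exact hy
  · intro hx
    refine ⟨e.symm x, ?_, by simp⟩
    simpa using hx

theorem FP.ext_closed (n : ℕ) : ∀ {A B C : Type} [AddCommGroup A] [Module R A] [AddCommGroup B]
    [Module R B] [AddCommGroup C] [Module R C] (f : A →ₗ[R] B) (g : B →ₗ[R] C),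
    Function.Injective f → Function.Surjective g → LinearMap.range f = LinearMap.ker g →
    FP R n A → FP R n C → FP R n B := by
  induction n with
  | zero =>
    intro A B C _ _ _ _ _ _ f g hf hg hfg hA hC
    have : Module.Finite R A := hA
    have : Module.Finite R C := hC
    refine ⟨Submodule.fg_of_fg_map_of_fg_inf_ker g ?_ ?_⟩
    · rw [Submodule.map_top, LinearMap.range_eq_top.2 hg]
      exact Module.Finite.fg_top
    · rw [top_inf_eq, ← hfg, LinearMap.range_eq_map]
      exact Module.Finite.fg_top.map f
  | succ n ih =>
    rintro A B C _ _ _ _ _ _ f g hf hg hfg ⟨k, p, hp, hkp⟩ ⟨l, q, hq, hkq⟩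
    obtain ⟨h, hh⟩ := Module.projective_lifting_property g q hg
    have hgh : ∀ y, g (h y) = q y := fun y => by rw [← hh]; rfl
    have hgf : ∀ a, g (f a) = 0 := fun a => by
      have : f a ∈ LinearMap.ker g := hfg ▸ ⟨a, rfl⟩
      exact this
    have hex : ∀ b, g b = 0 → ∃ a, f a = b := fun b hb => by
      have : b ∈ LinearMap.range f := by rw [hfg]; exact hb
      exact this
    let φ : ((Fin k → R) × (Fin l → R)) →ₗ[R] B := (f ∘ₗ p).coprod h
    have hφ : ∀ x y, φ (x, y) = f (p x) + h y := fun x y => by simp [φ]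
    have e : (Fin (k + l) → R) ≃ₗ[R] (Fin k → R) × (Fin l → R) :=
      (LinearEquiv.funCongrLeft R R finSumFinEquiv).trans (LinearEquiv.sumArrowLequivProdArrow _ _ R R)
    refine FP.succ_of e φ ?_ ?_
    · intro b
      obtain ⟨y, hy⟩ := hq (g b)
      obtain ⟨a, ha⟩ := hex (b - h y) (by rw [map_sub, hgh, hy, sub_self])
      obtain ⟨x, rfl⟩ := hp a
      exact ⟨(x, y), by rw [hφ, ha]; abel⟩
    · refine ih (A := LinearMap.ker p) (C := LinearMap.ker q)
        ((LinearMap.inl R _ _ ∘ₗ (LinearMap.ker p).subtype).codRestrict (LinearMap.ker φ) ?_)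
        ((LinearMap.snd R _ _ ∘ₗ (LinearMap.ker φ).subtype).codRestrict (LinearMap.ker q) ?_)
        ?_ ?_ ?_ hkp hkq
      · rintro ⟨x, hx⟩
        have hx : p x = 0 := hx
        show φ (x, 0) = 0
        rw [hφ, hx]; simp
      · rintro ⟨⟨x, y⟩, hx⟩
        have hx : φ (x, y) = 0 := hx
        show q y = 0
        have := congrArg g hx
        rw [hφ, map_add, hgf, hgh] at this
        simpa using this
      · rintro ⟨x, hx⟩ ⟨x', hx'⟩ hxx
        have := congrArg (fun z => z.1.1) hxx
        exact Subtype.ext this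
      · rintro ⟨y, hy⟩
        have hy : q y = 0 := hy
        obtain ⟨a, ha⟩ := hex (h y) (by rw [hgh, hy])
        obtain ⟨x, rfl⟩ := hp a
        refine ⟨⟨(-x, y), ?_⟩, rfl⟩
        show φ (-x, y) = 0
        rw [hφ, ← ha]; simp
      · ext ⟨⟨x, y⟩, hx⟩
        have hx0 : φ (x, y) = 0 := hx
        constructor
        · rintro ⟨⟨x', h'⟩, hxx⟩
          have := congrArg (fun z => z.1.2) hxx
          exact Subtype.ext this.symm
        · intro hz
          have hy : y = 0 := congrArg Subtype.val hz
          subst hy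
          refine ⟨⟨x, ?_⟩, rfl⟩
          rw [hφ, map_zero, add_zero] at hx0
          exact hf (by rw [hx0, map_zero])

theorem FP.coker {n : ℕ} {A B C : Type} [AddCommGroup A] [Module R A] [AddCommGroup B]
    [Module R B] [AddCommGroup C] [Module R C] (f : A →ₗ[R] B) (g : B →ₗ[R] C)
    (hf : Function.Injective f) (hg : Function.Surjective g)
    (hfg : LinearMap.range f = LinearMap.ker g)
    (hA : FP R n A) (hB : FP R (n + 1) B) : FP R (n + 1) C := by
  obtain ⟨k, p, hp, hkp⟩ := hB
  refine ⟨k, g ∘ₗ p, hg.comp hp, ?_⟩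
  have hA' : FP R n (LinearMap.ker g) :=
    hA.equiv ((LinearEquiv.ofInjective f hf).trans (LinearEquiv.ofEq _ _ hfg))
  have hle : LinearMap.ker p ≤ LinearMap.ker (g ∘ₗ p) := LinearMap.ker_le_ker_comp p g
  refine FP.ext_closed n (Submodule.inclusion hle)
    ((p ∘ₗ (LinearMap.ker (g ∘ₗ p)).subtype).codRestrict (LinearMap.ker g) ?_)
    (Submodule.inclusion_injective hle) ?_ ?_ hkp hA'
  · rintro ⟨x, hx⟩
    exact hx
  · rintro ⟨b, hb⟩
    obtain ⟨x, rfl⟩ := hp b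
    exact ⟨⟨x, hb⟩, rfl⟩
  · ext ⟨x, hx⟩
    constructor
    · rintro ⟨⟨x', h'⟩, hxx⟩
      have h1 : x' = x := congrArg Subtype.val hxx
      subst h1
      exact Subtype.ext h'
    · intro hz
      exact ⟨⟨x, congrArg Subtype.val hz⟩, rfl⟩

theorem FP.pred (n : ℕ) : ∀ {M : Type} [AddCommGroup M] [Module R M],
    FP R (n + 1) M → FP R n M := by
  induction n with
  | zero =>
    rintro M _ _ ⟨k, g, hg, -⟩
    exact Module.Finite.of_surjective g hg
  | succ n ih =>
    rintro M _ _ ⟨k, g, hg, hk⟩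
    exact ⟨k, g, hg, ih hk⟩

theorem FP.summand (n : ℕ) : ∀ {A B : Type} [AddCommGroup A] [Module R A] [AddCommGroup B]
    [Module R B], FP R n (A × B) → FP R n A := by
  induction n with
  | zero =>
    intro A B _ _ _ _ h
    have : Module.Finite R (A × B) := h
    exact Module.Finite.of_surjective (LinearMap.fst R A B) LinearMap.fst_surjective
  | succ n ih =>
    intro A B _ _ _ _ h
    have hB : FP R n B := ih (FP.equiv (LinearEquiv.prodComm R A B) (FP.pred n h))
    exact FP.coker (LinearMap.inr R A B) (LinearMap.fst R A B) LinearMap.inr_injective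
      LinearMap.fst_surjective (LinearMap.range_inr R A B) hB h

theorem FP.kernel {n : ℕ} {A B C : Type} [AddCommGroup A] [Module R A] [AddCommGroup B]
    [Module R B] [AddCommGroup C] [Module R C] (f : A →ₗ[R] B) (g : B →ₗ[R] C)
    (hf : Function.Injective f) (hg : Function.Surjective g)
    (hfg : LinearMap.range f = LinearMap.ker g)
    (hB : FP R n B) (hC : FP R (n + 1) C) : FP R n A := by
  obtain ⟨l, q, hq, hkq⟩ := hC
  obtain ⟨h, hh⟩ := Module.projective_lifting_property g q hg
  have hgh : ∀ y, g (h y) = q y := fun y => by rw [← hh]; rfl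
  have hgf : ∀ a, g (f a) = 0 := fun a => by
    have : f a ∈ LinearMap.ker g := hfg ▸ ⟨a, rfl⟩
    exact this
  have hex : ∀ b, g b = 0 → ∃ a, f a = b := fun b hb => by
    have : b ∈ LinearMap.range f := by rw [hfg]; exact hb
    exact this
  let φ : (A × (Fin l → R)) →ₗ[R] B := f.coprod h
  have hφ : ∀ x y, φ (x, y) = f x + h y := fun x y => by simp [φ]
  have hφs : Function.Surjective φ := by
    intro b
    obtain ⟨y, hy⟩ := hq (g b)
    obtain ⟨a, ha⟩ := hex (b - h y) (by rw [map_sub, hgh, hy, sub_self])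
    exact ⟨(a, y), by rw [hφ, ha]; abel⟩
  have e : LinearMap.ker φ ≃ₗ[R] LinearMap.ker q := by
    refine LinearEquiv.ofBijective
      ((LinearMap.snd R _ _ ∘ₗ (LinearMap.ker φ).subtype).codRestrict (LinearMap.ker q) ?_) ⟨?_, ?_⟩
    · rintro ⟨⟨x, y⟩, hx⟩
      have hx : φ (x, y) = 0 := hx
      show q y = 0
      have := congrArg g hx
      rw [hφ, map_add, hgf, hgh] at this
      simpa using this
    · rintro ⟨⟨x, y⟩, hx⟩ ⟨⟨x', y'⟩, hx'⟩ hxx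
      have hy : y = y' := congrArg Subtype.val hxx
      subst hy
      have hx : φ (x, y) = 0 := hx
      have hx' : φ (x', y) = 0 := hx'
      rw [hφ] at hx hx'
      have : x = x' := hf (add_right_cancel (hx.trans hx'.symm))
      subst this
      rfl
    · rintro ⟨y, hy⟩
      have hy : q y = 0 := hy
      obtain ⟨a, ha⟩ := hex (h y) (by rw [hgh, hy])
      refine ⟨⟨(-a, y), ?_⟩, rfl⟩
      show φ (-a, y) = 0
      rw [hφ, ← ha]; simp
  exact FP.summand n (FP.ext_closed n (LinearMap.ker φ).subtype φ Subtype.val_injective hφs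
    (Submodule.range_subtype _) (hkq.equiv e.symm) hB)

end FPsec

/-- Let `n ≥ 1` and let `R` be a strong `n`-coherent ring. Then the class of
finitely `n`-presented `R`-modules is thick: it is closed under direct summands, and in
every short exact sequence `0 → A → B → C → 0` in which two of `A`, `B`, `C` are finitely
`n`-presented, so is the third. -/
theorem finNPresented_thick
    (R : Type) [Ring R] (n : ℕ) (hn : 1 ≤ n) (hR : StrongNCoherent R n) :
    (∀ (A B : Type) [AddCommGroup A] [Module R A] [AddCommGroup B] [Module R B],
      IsFinNPresented R n (A × B) → IsFinNPresented R n A) ∧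
    (∀ (A B C : Type) [AddCommGroup A] [Module R A] [AddCommGroup B] [Module R B]
      [AddCommGroup C] [Module R C] (f : A →ₗ[R] B) (g : B →ₗ[R] C),
      Function.Injective f → Function.Surjective g →
      LinearMap.range f = LinearMap.ker g →
      ((IsFinNPresented R n A → IsFinNPresented R n B → IsFinNPresented R n C) ∧
       (IsFinNPresented R n A → IsFinNPresented R n C → IsFinNPresented R n B) ∧
       (IsFinNPresented R n B → IsFinNPresented R n C → IsFinNPresented R n A))) := by
  have tF := fun (M : Type) [AddCommGroup M] [Module R M] (h : IsFinNPresented R n M) =>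
    isFin_to_FP (R := R) n M h
  refine ⟨fun A B _ _ _ _ h => FP_to_isFin n _ (FP.summand n (tF _ h)), ?_⟩
  intro A B C _ _ _ _ _ _ f g hf hg hfg
  refine ⟨fun hA hB => ?_, fun hA hC => ?_, fun hB hC => ?_⟩
  · obtain ⟨m, rfl⟩ : ∃ m, n = m + 1 := ⟨n - 1, by omega⟩
    exact FP_to_isFin _ _ (FP.coker f g hf hg hfg (FP.pred m (tF _ hA)) (tF _ hB))
  · exact FP_to_isFin _ _ (FP.ext_closed n f g hf hg hfg (tF _ hA) (tF _ hC))
  · exact FP_to_isFin _ _ (FP.kernel f g hf hg hfg (tF _ hB) (isFin_to_FP _ _ (hR C hC)))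
end

section
/- For every ring R, the class of finitely ∞-presented R-modules is thick: it is closed under direct summands, and for every short exact sequence 0 → A → B → C → 0 of R-modules in which two of the three modules A, B, C are finitely ∞-presented, the third one is also finitely ∞-presented. -/
/-- An `R`-module `M` is finitely `∞`-presented if it admits a resolution
`⋯ → F_1 → F_0 → M → 0` by finitely generated free `R`-modules. -/
def IsFinInfPresented (R : Type) [Ring R] (M : Type) [AddCommGroup M] [Module R M] : Prop :=
  ∃ (k : ℕ → ℕ) (f : ∀ i : ℕ, (Fin (k (i + 1)) → R) →ₗ[R] (Fin (k i) → R))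
    (g : (Fin (k 0) → R) →ₗ[R] M),
    Function.Surjective g ∧
    LinearMap.ker g = LinearMap.range (f 0) ∧
    ∀ i : ℕ, LinearMap.ker (f i) = LinearMap.range (f (i + 1))


theorem fip_coind (R : Type) [Ring R]
    (S : ∀ (M : Type) [AddCommGroup M] [Module R M], Prop)
    (hS : ∀ (M : Type) [AddCommGroup M] [Module R M], S M →
      ∃ (k : ℕ) (g : (Fin k → R) →ₗ[R] M), Function.Surjective g ∧ S (LinearMap.ker g))
    (M : Type) [AddCommGroup M] [Module R M] (hM : S M) : IsFinInfPresented R M := by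
  obtain ⟨k0, g0, hg0, h0⟩ := hS M hM
  let T := {x : (Σ k : ℕ, Submodule R (Fin k → R)) // S x.2}
  have step : ∀ x : T, ∃ y : T, ∃ g : (Fin y.1.1 → R) →ₗ[R] x.1.2,
      Function.Surjective g ∧ LinearMap.ker g = y.1.2 := by
    intro x
    obtain ⟨k, g, hg, h⟩ := hS x.1.2 x.2
    exact ⟨⟨⟨k, LinearMap.ker g⟩, h⟩, g, hg, rfl⟩
  choose nx gg hgs hgk using step
  let st : ℕ → T := fun n => Nat.rec ⟨⟨k0, LinearMap.ker g0⟩, h0⟩ (fun _ x => nx x) n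
  refine ⟨fun n => (st n).1.1, fun n => (st n).1.2.subtype ∘ₗ gg (st n), g0, hg0, ?_, ?_⟩
  · rw [LinearMap.range_comp, LinearMap.range_eq_top.2 (hgs _), Submodule.map_top,
      Submodule.range_subtype]
    rfl
  · intro i
    rw [LinearMap.range_comp, LinearMap.range_eq_top.2 (hgs _), Submodule.map_top,
      Submodule.range_subtype, LinearMap.ker_comp, Submodule.ker_subtype]
    exact hgk (st i)

theorem fip_dest {R : Type} [Ring R] {M : Type} [AddCommGroup M] [Module R M]
    (h : IsFinInfPresented R M) :
    ∃ (k : ℕ) (g : (Fin k → R) →ₗ[R] M), Function.Surjective g ∧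
      IsFinInfPresented R (LinearMap.ker g) := by
  obtain ⟨k, f, g, hg, h0, hf⟩ := h
  have hm : ∀ x, f 0 x ∈ LinearMap.ker g := fun x => by rw [h0]; exact ⟨x, rfl⟩
  refine ⟨k 0, g, hg, fun n => k (n + 1), fun n => f (n + 1),
    (f 0).codRestrict (LinearMap.ker g) hm, ?_, ?_, fun i => hf (i + 1)⟩
  · rintro ⟨y, hy⟩
    rw [h0] at hy
    obtain ⟨x, rfl⟩ := hy
    exact ⟨x, rfl⟩
  · rw [LinearMap.ker_codRestrict]
    exact hf 0

theorem fip_mk {R : Type} [Ring R] {M : Type} [AddCommGroup M] [Module R M]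
    {k : ℕ} (g : (Fin k → R) →ₗ[R] M) (hg : Function.Surjective g)
    (h : IsFinInfPresented R (LinearMap.ker g)) : IsFinInfPresented R M :=
  fip_coind R (fun M _ _ => ∃ (k : ℕ) (g : (Fin k → R) →ₗ[R] M), Function.Surjective g ∧
      IsFinInfPresented R (LinearMap.ker g))
    (fun _ _ _ ⟨k, g, hg, h⟩ => ⟨k, g, hg, fip_dest h⟩) M ⟨k, g, hg, h⟩

theorem fip_equiv {R : Type} [Ring R] {M N : Type} [AddCommGroup M] [Module R M]
    [AddCommGroup N] [Module R N] (e : M ≃ₗ[R] N) (h : IsFinInfPresented R M) :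
    IsFinInfPresented R N := by
  obtain ⟨k, g, hg, h⟩ := fip_dest h
  refine fip_mk (e.toLinearMap ∘ₗ g) (e.surjective.comp hg) ?_
  rwa [LinearEquiv.ker_comp]

theorem fip_subsing {R : Type} [Ring R] {M : Type} [AddCommGroup M] [Module R M]
    [Subsingleton M] : IsFinInfPresented R M :=
  fip_coind R (fun M _ _ => Subsingleton M)
    (fun M _ _ _ => ⟨0, 0, fun x => ⟨0, Subsingleton.elim _ _⟩, inferInstance⟩) M ‹_›

theorem fip_free {R : Type} [Ring R] (k : ℕ) : IsFinInfPresented R (Fin k → R) := by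
  refine fip_mk LinearMap.id Function.surjective_id ?_
  rw [LinearMap.ker_id]
  exact fip_subsing

def fipE (R : Type) [Ring R] (a b : ℕ) : (Fin (a + b) → R) ≃ₗ[R] (Fin a → R) × (Fin b → R) :=
  (LinearEquiv.funCongrLeft R R finSumFinEquiv).trans (LinearEquiv.sumArrowLequivProdArrow _ _ R R)

theorem fip_ext {R : Type} [Ring R] {A B C : Type} [AddCommGroup A] [Module R A]
    [AddCommGroup B] [Module R B] [AddCommGroup C] [Module R C] (f : A →ₗ[R] B) (g : B →ₗ[R] C)
    (hf : Function.Injective f) (hg : Function.Surjective g)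
    (hfg : LinearMap.range f = LinearMap.ker g)
    (hA : IsFinInfPresented R A) (hC : IsFinInfPresented R C) : IsFinInfPresented R B := by
  refine fip_coind R (fun B _ _ => ∃ (A C : Type) (_ : AddCommGroup A) (_ : Module R A)
    (_ : AddCommGroup C) (_ : Module R C) (f : A →ₗ[R] B) (g : B →ₗ[R] C),
    Function.Injective f ∧ Function.Surjective g ∧ LinearMap.range f = LinearMap.ker g ∧
    IsFinInfPresented R A ∧ IsFinInfPresented R C) ?_ B
    ⟨A, C, _, _, _, _, f, g, hf, hg, hfg, hA, hC⟩
  clear hf hg hfg hA hC f g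
  rintro B _ _ ⟨A, C, _, _, _, _, f, g, hf, hg, hfg, hA, hC⟩
  obtain ⟨a, p, hp, hKp⟩ := fip_dest hA
  obtain ⟨c, q, hq, hKq⟩ := fip_dest hC
  obtain ⟨l, hl⟩ := Module.projective_lifting_property g q hg
  have hl' : ∀ y, g (l y) = q y := fun y => by rw [← hl]; rfl
  have hgf : ∀ x, g (f x) = 0 := fun x => by
    have : f x ∈ LinearMap.ker g := hfg ▸ ⟨x, rfl⟩
    exact this
  have hex : ∀ b, g b = 0 → ∃ x, f (p x) = b := fun b hb => by
    have : b ∈ LinearMap.range f := hfg ▸ hb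
    obtain ⟨x, rfl⟩ := this
    obtain ⟨y, rfl⟩ := hp x
    exact ⟨y, rfl⟩
  let e := fipE R a c
  let h : (Fin (a + c) → R) →ₗ[R] B := (f ∘ₗ p).coprod l ∘ₗ e.toLinearMap
  have hh : ∀ x, h x = f (p (e x).1) + l (e x).2 := fun x => rfl
  have hi : ∀ x : LinearMap.ker p, (e.symm.toLinearMap ∘ₗ LinearMap.inl R _ _ ∘ₗ
      (LinearMap.ker p).subtype) x ∈ LinearMap.ker h := by
    rintro ⟨x, hx⟩
    rw [LinearMap.mem_ker, hh]
    rw [LinearMap.mem_ker] at hx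
    simp [hx]
  have hj : ∀ x : LinearMap.ker h, (LinearMap.snd R _ _ ∘ₗ e.toLinearMap ∘ₗ
      (LinearMap.ker h).subtype) x ∈ LinearMap.ker q := by
    rintro ⟨x, hx⟩
    rw [LinearMap.mem_ker, hh] at hx
    have := congrArg g hx
    rw [map_add, hgf, hl', zero_add, map_zero] at this
    exact this
  refine ⟨a + c, h, ?_, LinearMap.ker p, LinearMap.ker q, _, _, _, _,
    LinearMap.codRestrict _ _ hi, LinearMap.codRestrict _ _ hj, ?_, ?_, ?_, hKp, hKq⟩
  · intro b
    obtain ⟨y, hy⟩ := hq (g b)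
    obtain ⟨x, hx⟩ := hex (b - l y) (by rw [map_sub, hl', hy, sub_self])
    refine ⟨e.symm (x, y), ?_⟩
    rw [hh]
    simp [hx]
  · intro x y hxy
    have := congrArg Subtype.val hxy
    simpa using this
  · rintro ⟨y, hy⟩
    obtain ⟨x, hx⟩ := hex (l y) (by rw [hl']; exact hy)
    refine ⟨⟨e.symm (-x, y), ?_⟩, ?_⟩
    · rw [LinearMap.mem_ker, hh]
      simp [hx]
    · ext1
      simp
  · ext ⟨x, hx⟩
    constructor
    · rintro ⟨y, hy⟩
      rw [← hy]
      ext1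
      simp
    · intro hx2
      have h2 : (e x).2 = 0 := congrArg Subtype.val hx2
      have hx' := hx
      rw [LinearMap.mem_ker, hh, h2, map_zero, add_zero] at hx'
      refine ⟨⟨(e x).1, hf (by rw [hx', map_zero])⟩, ?_⟩
      ext1
      change e.symm ((e x).1, 0) = x
      rw [← h2]
      exact e.symm_apply_apply x

theorem fip_coker {R : Type} [Ring R] {A B C : Type} [AddCommGroup A] [Module R A]
    [AddCommGroup B] [Module R B] [AddCommGroup C] [Module R C] (f : A →ₗ[R] B) (g : B →ₗ[R] C)
    (hf : Function.Injective f) (hg : Function.Surjective g)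
    (hfg : LinearMap.range f = LinearMap.ker g)
    (hA : IsFinInfPresented R A) (hB : IsFinInfPresented R B) : IsFinInfPresented R C := by
  obtain ⟨k, p, hp, hK⟩ := fip_dest hB
  refine fip_mk (g ∘ₗ p) (hg.comp hp) ?_
  have hA' : IsFinInfPresented R (LinearMap.ker g) :=
    fip_equiv ((LinearEquiv.ofInjective f hf).trans (LinearEquiv.ofEq _ _ hfg)) hA
  have hle : LinearMap.ker p ≤ LinearMap.ker (g ∘ₗ p) := LinearMap.ker_le_ker_comp p g
  have hm : ∀ x : LinearMap.ker (g ∘ₗ p),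
      (p ∘ₗ (LinearMap.ker (g ∘ₗ p)).subtype) x ∈ LinearMap.ker g := fun x => x.2
  refine fip_ext (Submodule.inclusion hle)
    ((p ∘ₗ (LinearMap.ker (g ∘ₗ p)).subtype).codRestrict (LinearMap.ker g) hm)
    (Submodule.inclusion_injective hle) ?_ ?_ hK hA'
  · rintro ⟨y, hy⟩
    obtain ⟨x, rfl⟩ := hp y
    exact ⟨⟨x, hy⟩, rfl⟩
  · rw [LinearMap.ker_codRestrict, Submodule.range_inclusion]
    rfl

theorem fip_ker {R : Type} [Ring R] {A B C : Type} [AddCommGroup A] [Module R A]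
    [AddCommGroup B] [Module R B] [AddCommGroup C] [Module R C] (f : A →ₗ[R] B) (g : B →ₗ[R] C)
    (hf : Function.Injective f) (hg : Function.Surjective g)
    (hfg : LinearMap.range f = LinearMap.ker g)
    (hB : IsFinInfPresented R B) (hC : IsFinInfPresented R C) : IsFinInfPresented R A := by
  obtain ⟨k, p, hp, hK⟩ := fip_dest hC
  obtain ⟨l, hl⟩ := Module.projective_lifting_property g p hg
  have hl' : ∀ y, g (l y) = p y := fun y => by rw [← hl]; rfl
  have hgf : ∀ x, g (f x) = 0 := fun x => by
    have : f x ∈ LinearMap.ker g := hfg ▸ ⟨x, rfl⟩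
    exact this
  have hex : ∀ b, g b = 0 → ∃ x, f x = b := fun b hb => by
    have : b ∈ LinearMap.range f := hfg ▸ hb
    exact this
  -- the sequence 0 → ker p → A × F → B → 0
  have hm : ∀ y : LinearMap.ker p, ∃ x, f x = l y := fun y => hex _ (by rw [hl']; exact y.2)
  let ι := LinearEquiv.ofInjective f hf
  have hr : ∀ y : LinearMap.ker p, (l ∘ₗ (LinearMap.ker p).subtype) y ∈ LinearMap.range f := hm
  let m : LinearMap.ker p →ₗ[R] A := ι.symm.toLinearMap ∘ₗ LinearMap.codRestrict _ _ hr
  have hfm : ∀ y, f (m y) = l y := fun y =>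
    congrArg Subtype.val (ι.apply_symm_apply (LinearMap.codRestrict _ _ hr y))
  have hE : IsFinInfPresented R (A × (Fin k → R)) := by
    refine fip_ext ((-m).prod (LinearMap.ker p).subtype) (f.coprod l) ?_ ?_ ?_ hK hB
    · intro x y hxy
      exact Subtype.ext (congrArg Prod.snd hxy)
    · intro b
      obtain ⟨y, hy⟩ := hp (g b)
      obtain ⟨x, hx⟩ := hex (b - l y) (by rw [map_sub, hl', hy, sub_self])
      exact ⟨(x, y), by simp [hx]⟩
    · ext ⟨x, y⟩
      constructor
      · rintro ⟨z, hz⟩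
        rw [← hz]
        simp [hfm]
      · intro h
        have h' : f x + l y = 0 := h
        have hy : p y = 0 := by
          have := congrArg g h'
          rwa [map_add, hgf, hl', zero_add, map_zero] at this
        refine ⟨⟨y, hy⟩, Prod.ext (hf ?_) rfl⟩
        change f (-(m ⟨y, hy⟩)) = f x
        rw [map_neg, hfm]
        exact (eq_neg_of_add_eq_zero_left h').symm
  exact fip_coker (LinearMap.inr R A (Fin k → R)) (LinearMap.fst R A (Fin k → R))
    LinearMap.inr_injective LinearMap.fst_surjective
    (LinearMap.range_inr R A (Fin k → R)) (fip_free k) hE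

theorem fip_summand {R : Type} [Ring R] {A B : Type} [AddCommGroup A] [Module R A]
    [AddCommGroup B] [Module R B] (h : IsFinInfPresented R (A × B)) : IsFinInfPresented R A := by
  refine fip_coind R (fun A _ _ => ∃ (B : Type) (_ : AddCommGroup B) (_ : Module R B),
    IsFinInfPresented R (A × B)) ?_ A ⟨B, _, _, h⟩
  clear h
  rintro A _ _ ⟨B, _, _, h⟩
  obtain ⟨k, p, hp, -⟩ := fip_dest h
  have hF : IsFinInfPresented R ((Fin k → R) × (Fin k → R)) := fip_equiv (fipE R k k) (fip_free _)
  let pa := LinearMap.fst R A B ∘ₗ p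
  let pb := LinearMap.snd R A B ∘ₗ p
  have ha : Function.Surjective pa := (LinearMap.fst_surjective (R := R) (M := A) (M₂ := B)).comp hp
  have hb : Function.Surjective pb := (LinearMap.snd_surjective (R := R) (M := A) (M₂ := B)).comp hp
  refine ⟨k, pa, ha, LinearMap.ker pb, inferInstance, inferInstance, ?_⟩
  refine fip_ker ((LinearMap.ker pa).subtype.prodMap (LinearMap.ker pb).subtype)
    (pa.prodMap pb) ?_ ?_ ?_ hF h
  · exact Function.Injective.prodMap Subtype.val_injective Subtype.val_injective
  · exact Function.Surjective.prodMap ha hb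
  · rw [LinearMap.range_prodMap, LinearMap.ker_prodMap, Submodule.range_subtype,
      Submodule.range_subtype]

/-- For every ring `R`, the class of finitely `∞`-presented `R`-modules is
thick: it is closed under direct summands, and in every short exact sequence
`0 → A → B → C → 0` in which two of `A`, `B`, `C` are finitely `∞`-presented, so is the
third. -/
theorem finInfPresented_thick (R : Type) [Ring R] :
    (∀ (A B : Type) [AddCommGroup A] [Module R A] [AddCommGroup B] [Module R B],
      IsFinInfPresented R (A × B) → IsFinInfPresented R A) ∧
    (∀ (A B C : Type) [AddCommGroup A] [Module R A] [AddCommGroup B] [Module R B]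
      [AddCommGroup C] [Module R C] (f : A →ₗ[R] B) (g : B →ₗ[R] C),
      Function.Injective f → Function.Surjective g →
      LinearMap.range f = LinearMap.ker g →
      ((IsFinInfPresented R A → IsFinInfPresented R B → IsFinInfPresented R C) ∧
       (IsFinInfPresented R A → IsFinInfPresented R C → IsFinInfPresented R B) ∧
       (IsFinInfPresented R B → IsFinInfPresented R C → IsFinInfPresented R A))) := by
  refine ⟨fun A B _ _ _ _ h => fip_summand h, ?_⟩
  intro A B C _ _ _ _ _ _ f g hf hg hfg
  exact ⟨fip_coker f g hf hg hfg, fip_ext f g hf hg hfg, fip_ker f g hf hg hfg⟩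
end

section
/- Let n ≥ 1 and let R be a commutative ring. Then every finitely n-presented R-module is projective (i.e. R is n-Von Neumann regular) if and only if the following three conditions hold: (a) R is strong n-coherent; (b) R is n-regular, i.e. every finitely n-presented R-module has finite projective dimension; (c) every finitely generated proper ideal of R has a nonzero annihilator, i.e. for every finitely generated ideal I ≠ R there exists r ∈ R, r ≠ 0, with rI = 0. -/
/-- A finite resolution `0 → P_d → ⋯ → P_1 → P_0 → M → 0` of `M` by projective
`R`-modules, encoded as an infinite exact chain of projective modules vanishing in
degrees `> len`. `M` has finite projective dimension iff such a resolution exists. -/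
structure FiniteProjResolution (R : Type) [Ring R] (M : Type) [AddCommGroup M]
    [Module R M] : Type 1 where
  len : ℕ
  P : ℕ → Type
  [acg : ∀ i, AddCommGroup (P i)]
  [mod : ∀ i, Module R (P i)]
  proj : ∀ i, Module.Projective R (P i)
  f : ∀ i : ℕ, P (i + 1) →ₗ[R] P i
  g : P 0 →ₗ[R] M
  surj : Function.Surjective g
  exact0 : LinearMap.ker g = LinearMap.range (f 0)
  exact : ∀ i : ℕ, LinearMap.ker (f i) = LinearMap.range (f (i + 1))
  bounded : ∀ i : ℕ, len < i → ∀ x : P i, x = 0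

/-- A ring `R` is `n`-regular if every finitely `n`-presented `R`-module has finite
projective dimension. -/
def NRegular (R : Type) [Ring R] (n : ℕ) : Prop :=
  ∀ (M : Type) [AddCommGroup M] [Module R M],
    IsFinNPresented R n M → Nonempty (FiniteProjResolution R M)


open CategoryTheory in
theorem aux_pd_step {R : Type} [CommRing R] {N M : Type} [AddCommGroup N] [Module R N]
    [AddCommGroup M] [Module R M] [Module.Projective R N] (f : N →ₗ[R] M)
    (hf : Function.Surjective f) (n : ℕ)
    (h : HasProjectiveDimensionLT (ModuleCat.of R (LinearMap.ker f)) n) :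
    HasProjectiveDimensionLT (ModuleCat.of R M) (n + 1) := by
  have hS := LinearMap.shortExact_shortComplexKer hf
  have : Projective (ModuleCat.of R N) := (IsProjective.iff_projective N).mp inferInstance
  have h2 : HasProjectiveDimensionLT (ModuleCat.of R N) (n + 1) :=
    hasProjectiveDimensionLT_of_ge _ 1 (n + 1) (by omega)
  exact hS.hasProjectiveDimensionLT_X₃ n h h2

open CategoryTheory in
theorem aux_pd_ker {R : Type} [CommRing R] {N M : Type} [AddCommGroup N] [Module R N]
    [AddCommGroup M] [Module R M] [Module.Projective R N] (f : N →ₗ[R] M)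
    (hf : Function.Surjective f) (n : ℕ)
    (h : HasProjectiveDimensionLT (ModuleCat.of R M) (n + 2)) :
    HasProjectiveDimensionLT (ModuleCat.of R (LinearMap.ker f)) (n + 1) := by
  have hS := LinearMap.shortExact_shortComplexKer hf
  have : Projective (ModuleCat.of R N) := (IsProjective.iff_projective N).mp inferInstance
  exact (hS.hasProjectiveDimensionLT_X₃_iff n this).mp h

open CategoryTheory in
theorem aux_pd_of_res {R : Type} [CommRing R] {M : Type} [AddCommGroup M] [Module R M]
    (F : FiniteProjResolution R M) :
    HasProjectiveDimensionLT (ModuleCat.of R M) (F.len + 2) := by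
  letI := F.acg
  letI := F.mod
  have := F.proj
  have key : ∀ j i, F.len ≤ i + j →
      HasProjectiveDimensionLT (ModuleCat.of R (LinearMap.ker (F.f i))) j := by
    intro j
    induction j with
    | zero =>
      intro i hi
      apply Limits.IsZero.hasProjectiveDimensionLT_zero
      have : Subsingleton (LinearMap.ker (F.f i)) := by
        refine ⟨fun a b => Subtype.ext ?_⟩
        rw [F.bounded (i+1) (by omega) a.1, F.bounded (i+1) (by omega) b.1]
      exact ModuleCat.isZero_of_subsingleton _
    | succ j ih =>
      intro i hi
      have h1 := ih (i+1) (by omega)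
      have hm : ∀ x, F.f (i+1) x ∈ LinearMap.ker (F.f i) := fun x => by
        rw [F.exact i]; exact ⟨x, rfl⟩
      refine aux_pd_step ((F.f (i+1)).codRestrict _ hm) ?_ j ?_
      · rintro ⟨y, hy⟩
        rw [F.exact i] at hy
        obtain ⟨x, rfl⟩ := hy
        exact ⟨x, rfl⟩
      · rw [LinearMap.ker_codRestrict]; exact h1
  have hm : ∀ x, F.f 0 x ∈ LinearMap.ker F.g := fun x => by
    rw [F.exact0]; exact ⟨x, rfl⟩
  refine aux_pd_step F.g F.surj _ ?_
  refine aux_pd_step ((F.f 0).codRestrict _ hm) ?_ _ ?_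
  · rintro ⟨y, hy⟩
    rw [F.exact0] at hy
    obtain ⟨x, rfl⟩ := hy
    exact ⟨x, rfl⟩
  · rw [LinearMap.ker_codRestrict]; exact key _ _ (by omega)

theorem aux_zero {R : Type} [CommRing R] {M : Type} [AddCommGroup M] [Module R M]
    [Module.Finite R M] : IsFinNPresented R 0 M := by
  obtain ⟨m, g, hg⟩ := Module.Finite.exists_fin' R M
  exact ⟨fun _ => m, fun _ => 0, g, hg, by simp, by simp⟩

theorem aux_fin {R : Type} [CommRing R] {M : Type} [AddCommGroup M] [Module R M] {n : ℕ}
    (h : IsFinNPresented R n M) : Module.Finite R M := by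
  obtain ⟨k, f, g, hg, -⟩ := h
  exact Module.Finite.of_surjective g hg

theorem aux_succ {R : Type} [CommRing R] {M : Type} [AddCommGroup M] [Module R M] {n : ℕ}
    (h : IsFinNPresented R (n + 1) M) :
    ∃ (m : ℕ) (g : (Fin m → R) →ₗ[R] M), Function.Surjective g ∧
      IsFinNPresented R n (LinearMap.ker g) := by
  obtain ⟨k, f, g, hg, h0, h1⟩ := h
  have hk := h0 (by omega)
  have hm : ∀ x, f 0 x ∈ LinearMap.ker g := fun x => by
    rw [hk]; exact ⟨x, rfl⟩
  refine ⟨k 0, g, hg, fun i => k (i+1), fun i => f (i+1), (f 0).codRestrict _ hm, ?_, ?_, ?_⟩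
  · rintro ⟨y, hy⟩
    rw [hk] at hy
    obtain ⟨x, rfl⟩ := hy
    exact ⟨x, rfl⟩
  · intro hn
    rw [LinearMap.ker_codRestrict]
    exact h1 0 (by omega)
  · intro i hi
    exact h1 (i+1) (by omega)

theorem aux_of_ker {R : Type} [CommRing R] {M : Type} [AddCommGroup M] [Module R M] {n m : ℕ}
    (g : (Fin m → R) →ₗ[R] M) (hg : Function.Surjective g)
    (h : IsFinNPresented R n (LinearMap.ker g)) : IsFinNPresented R (n + 1) M := by
  obtain ⟨k, f, g', hg', h0, h1⟩ := h
  let k' : ℕ → ℕ := fun i => Nat.casesOn i m k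
  let f' : ∀ i : ℕ, (Fin (k' (i + 1)) → R) →ₗ[R] (Fin (k' i) → R) := fun i =>
    match i with
    | 0 => (LinearMap.ker g).subtype ∘ₗ g'
    | i + 1 => f i
  refine ⟨k', f', g, hg, fun _ => ?_, ?_⟩
  · change _ = LinearMap.range ((LinearMap.ker g).subtype ∘ₗ g')
    rw [LinearMap.range_comp, LinearMap.range_eq_top.mpr hg', Submodule.map_top,
      Submodule.range_subtype]
  · rintro (_ | i) hi
    · change LinearMap.ker ((LinearMap.ker g).subtype ∘ₗ g') = LinearMap.range (f 0)
      rw [LinearMap.ker_comp, Submodule.ker_subtype, ← h0 (by omega)]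
      rfl
    · exact h1 i (by omega)

theorem aux_proj_pres {R : Type} [CommRing R] (n : ℕ) : ∀ (M : Type) [AddCommGroup M]
    [Module R M] [Module.Finite R M] [Module.Projective R M], IsFinNPresented R n M := by
  induction n with
  | zero => intro M _ _ _ _; exact aux_zero
  | succ n ih =>
    intro M _ _ _ _
    obtain ⟨m, f, g, hf, hg, hfg⟩ := Module.Finite.exists_comp_eq_id_of_projective R M
    have hP : Module.Projective R (LinearMap.ker f) := by
      obtain ⟨-, l, hl⟩ := ((Function.Exact.split_tfae'
        (f.exact_subtype_ker_map)).out 0 1 rfl rfl).mp ⟨Subtype.val_injective, g, hfg⟩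
      exact Module.Projective.of_split _ l hl
    have hF : Module.Finite R (LinearMap.ker f) := by
      have := Module.finitePresentation_of_projective R M
      exact Module.Finite.of_fg (Module.FinitePresentation.fg_ker f hf)
    exact aux_of_ker f hf (ih _)

theorem aux_res {R : Type} [CommRing R] (M : Type) [AddCommGroup M]
    [Module R M] [Module.Projective R M] : Nonempty (FiniteProjResolution R M) := by
  have hs : ∀ i : ℕ, Subsingleton ↥(if i + 1 = 0 then ⊤ else ⊥ : Submodule R M) := by
    intro i
    rw [if_neg (by omega)]
    infer_instance
  refine ⟨{ len := 0, P := fun i => ↥(if i = 0 then ⊤ else ⊥ : Submodule R M),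
            proj := ?_, f := fun _ => 0, g := Submodule.subtype _, surj := ?_, exact0 := ?_,
            exact := ?_, bounded := ?_ }⟩
  · rintro (_ | i)
    · exact Module.Projective.of_equiv (Submodule.topEquiv (R := R) (M := M)).symm
    · have := hs i
      infer_instance
  · intro x
    exact ⟨⟨x, by simp⟩, rfl⟩
  · rw [Submodule.ker_subtype, LinearMap.range_zero]
  · intro i
    have := hs i
    exact Subsingleton.elim _ _
  · rintro (_ | i) hi x
    · omega
    · have := hs i
      exact Subsingleton.elim _ _

theorem aux_hom {R : Type} [CommRing R]
    (hc : ∀ I : Ideal R, I.FG → I ≠ ⊤ → ∃ r : R, r ≠ 0 ∧ ∀ x ∈ I, r * x = 0)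
    (C : Type) [AddCommGroup C] [Module R C] [Module.FinitePresentation R C]
    (s : Finset C) : ∀ L : Submodule R C, L.FG → L ≠ ⊤ → L ⊔ Submodule.span R (s : Set C) = ⊤ →
      ∃ φ : C →ₗ[R] R, φ ≠ 0 := by
  classical
  induction s using Finset.induction_on with
  | empty => intro L _ h1 h2; simp at h2; exact absurd h2 h1
  | insert a s _ ih =>
    intro L hL h1 h2
    by_cases h : L ⊔ Submodule.span R {a} = ⊤
    · have hQ : Module.FinitePresentation R (C ⧸ L) :=
        Module.finitePresentation_of_surjective L.mkQ L.mkQ_surjective (by simpa using hL)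
      let t : R →ₗ[R] C ⧸ L := LinearMap.toSpanSingleton R _ (L.mkQ a)
      have ht : Function.Surjective t := by
        intro q
        obtain ⟨c, rfl⟩ := L.mkQ_surjective q
        have : c ∈ L ⊔ Submodule.span R {a} := by rw [h]; trivial
        obtain ⟨l, hl, y, hy, rfl⟩ := Submodule.mem_sup.mp this
        obtain ⟨r, rfl⟩ := Submodule.mem_span_singleton.mp hy
        refine ⟨r, ?_⟩
        have : L.mkQ l = 0 := by simpa using hl
        rw [map_add, this]
        simp [t]
      have hne : LinearMap.ker t ≠ ⊤ := by
        intro hk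
        have h1' : (1 : R) ∈ LinearMap.ker t := by rw [hk]; trivial
        have : a ∈ L := by simpa [t] using h1'
        apply h1
        rw [← h, left_eq_sup, Submodule.span_le]
        simpa using this
      obtain ⟨r, hr, hr'⟩ := hc (LinearMap.ker t) (Module.FinitePresentation.fg_ker t ht) hne
      let e := t.quotKerEquivOfSurjective ht
      let u : (R ⧸ LinearMap.ker t) →ₗ[R] R := (LinearMap.ker t).liftQ (LinearMap.mulLeft R r)
        (fun x hx => hr' x hx)
      refine ⟨u ∘ₗ e.symm.toLinearMap ∘ₗ L.mkQ, fun h0 => hr ?_⟩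
      have hea : e.symm (L.mkQ a) = (LinearMap.ker t).mkQ 1 := by
        rw [LinearEquiv.symm_apply_eq]
        change L.mkQ a = t 1
        simp [t]
      have := LinearMap.congr_fun h0 a
      simp only [LinearMap.comp_apply, LinearEquiv.coe_coe, hea] at this
      have h3 : u ((LinearMap.ker t).mkQ 1) = r * 1 := rfl
      rw [h3] at this
      simpa using this
    · refine ih _ (hL.sup (Submodule.fg_span_singleton a)) h ?_
      rw [sup_assoc, ← Submodule.span_union]
      simpa using h2

theorem aux_dual_surj {R : Type} [CommRing R]
    (hc : ∀ I : Ideal R, I.FG → I ≠ ⊤ → ∃ r : R, r ≠ 0 ∧ ∀ x ∈ I, r * x = 0)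
    (K : Type) [AddCommGroup K] [Module R K] [Module.Finite R K] [Module.Projective R K]
    (m : ℕ) (i : K →ₗ[R] (Fin m → R)) (hi : Function.Injective i) :
    Function.Surjective (Module.Dual.transpose (R := R) i) := by
  rw [← LinearMap.range_eq_top]
  set N := LinearMap.range (Module.Dual.transpose (R := R) i) with hN
  by_contra hne
  have hfg : N.FG := Submodule.fg_range _
  have : Module.FinitePresentation R (Module.Dual R K) :=
    Module.finitePresentation_of_projective R _
  have : Module.FinitePresentation R (Module.Dual R K ⧸ N) :=
    Module.finitePresentation_of_surjective N.mkQ N.mkQ_surjective (by simpa using hfg)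
  obtain ⟨s, hs⟩ := Module.Finite.fg_top (R := R) (M := Module.Dual R K ⧸ N)
  have hbt : (⊥ : Submodule R (Module.Dual R K ⧸ N)) ≠ ⊤ := by
    intro h
    have := congrArg (Submodule.comap N.mkQ) h
    apply hne
    simpa using this
  obtain ⟨φ, hφ⟩ := aux_hom hc (Module.Dual R K ⧸ N) s ⊥ Submodule.fg_bot hbt (by simp [hs])
  obtain ⟨x, hx⟩ := (Module.evalEquiv R K).surjective (φ ∘ₗ N.mkQ)
  have hx' : ∀ f : Module.Dual R K, f x = φ (N.mkQ f) := fun f => by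
    have := LinearMap.congr_fun hx f
    simpa using this
  have hix : i x = 0 := by
    ext j
    have h1 := hx' ((LinearMap.proj j) ∘ₗ i)
    have h2 : N.mkQ ((LinearMap.proj j) ∘ₗ i) = 0 := by
      rw [Submodule.mkQ_apply, Submodule.Quotient.mk_eq_zero]
      exact ⟨LinearMap.proj j, rfl⟩
    rw [h2] at h1
    simpa using h1
  have hx0 : x = 0 := hi (by simpa using hix)
  apply hφ
  ext q
  have := hx' q
  rw [hx0] at this
  simpa using this.symm

theorem aux_split {R : Type} [CommRing R]
    (hc : ∀ I : Ideal R, I.FG → I ≠ ⊤ → ∃ r : R, r ≠ 0 ∧ ∀ x ∈ I, r * x = 0)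
    (K : Type) [AddCommGroup K] [Module R K] [Module.Finite R K] [Module.Projective R K]
    (m : ℕ) (i : K →ₗ[R] (Fin m → R)) (hi : Function.Injective i) :
    ∃ l, l ∘ₗ i = LinearMap.id := by
  obtain ⟨p, f, g, hf, hg, hfg⟩ := Module.Finite.exists_comp_eq_id_of_projective R K
  choose ψ hψ using fun j => aux_dual_surj hc K m i hi ((LinearMap.proj j) ∘ₗ g)
  refine ⟨f ∘ₗ LinearMap.pi ψ, ?_⟩
  rw [← hfg, LinearMap.comp_assoc]
  congr 1
  apply LinearMap.ext
  intro x
  funext j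
  exact LinearMap.congr_fun (hψ j) x

open CategoryTheory in
theorem aux_back {R : Type} [CommRing R] (n : ℕ)
    (hc : ∀ I : Ideal R, I.FG → I ≠ ⊤ → ∃ r : R, r ≠ 0 ∧ ∀ x ∈ I, r * x = 0)
    (ha : StrongNCoherent R n) (d : ℕ) : ∀ (M : Type) [AddCommGroup M] [Module R M],
    IsFinNPresented R n M → HasProjectiveDimensionLT (ModuleCat.of R M) (d + 1) →
    Module.Projective R M := by
  induction d with
  | zero =>
    intro M _ _ _ h
    rw [zero_add, ← projective_iff_hasProjectiveDimensionLT_one] at h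
    exact (IsProjective.iff_projective M).mpr h
  | succ d ih =>
    intro M _ _ hM h
    obtain ⟨m, g, hg, hK⟩ := aux_succ (ha M hM)
    have := ih _ hK (aux_pd_ker g hg d h)
    have := aux_fin hK
    obtain ⟨l, hl⟩ := aux_split hc _ m (LinearMap.ker g).subtype Subtype.val_injective
    obtain ⟨-, l', hl'⟩ := ((Function.Exact.split_tfae'
        (g.exact_subtype_ker_map)).out 0 1 rfl rfl).mpr ⟨hg, l, hl⟩
    exact Module.Projective.of_split l' g hl'

theorem aux_ann {R : Type} [CommRing R] (n : ℕ)
    (H : ∀ (M : Type) [AddCommGroup M] [Module R M],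
        IsFinNPresented R n M → Module.Projective R M) (hn : 1 ≤ n)
    (I : Ideal R) (hI : I.FG) (hne : I ≠ ⊤) : ∃ r : R, r ≠ 0 ∧ ∀ x ∈ I, r * x = 0 := by
  by_contra! hcon
  obtain ⟨m, x, rfl⟩ := Submodule.fg_iff_exists_fin_generating_family.mp hI
  let i : R →ₗ[R] (Fin m → R) := LinearMap.toSpanSingleton R _ x
  have hi : Function.Injective i := by
    rw [← LinearMap.ker_eq_bot, LinearMap.ker_eq_bot']
    intro r hr
    by_contra hr0
    obtain ⟨y, hy, hry⟩ := hcon r hr0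
    apply hry
    have hle : Submodule.span R (Set.range x) ≤ LinearMap.ker (LinearMap.mulLeft R r) := by
      rw [Submodule.span_le]
      rintro _ ⟨j, rfl⟩
      exact congrFun hr j
    exact hle hy
  obtain ⟨k, rfl⟩ : ∃ k, n = k + 1 := ⟨n - 1, by omega⟩
  have hex : Function.Exact i (LinearMap.range i).mkQ := LinearMap.exact_map_mkQ_range i
  have hP : Module.Projective R ((Fin m → R) ⧸ LinearMap.range i) := by
    apply H
    refine aux_of_ker (LinearMap.range i).mkQ (Submodule.mkQ_surjective _) ?_
    rw [Submodule.ker_mkQ]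
    have e := LinearEquiv.ofInjective i hi
    have : Module.Projective R (LinearMap.range i) := Module.Projective.of_equiv e
    exact aux_proj_pres k _
  obtain ⟨s, hs⟩ := Module.projective_lifting_property (LinearMap.range i).mkQ LinearMap.id
    (Submodule.mkQ_surjective _)
  obtain ⟨-, l, hl⟩ := ((Function.Exact.split_tfae' hex).out 0 1 rfl rfl).mp ⟨hi, s, hs⟩
  apply hne
  rw [Ideal.eq_top_iff_one]
  have h1 : l x = 1 := by
    have := LinearMap.congr_fun hl 1
    simpa [i] using this
  rw [← h1, LinearMap.pi_apply_eq_sum_univ l x]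
  refine Submodule.sum_mem _ fun j _ => ?_
  rw [smul_eq_mul]
  exact Ideal.mul_mem_right _ _ (Submodule.subset_span ⟨j, rfl⟩)

/-- Let `n ≥ 1` and `R` a commutative ring. Every finitely `n`-presented
`R`-module is projective (i.e. `R` is `n`-Von Neumann regular) if and only if `R` is
strong `n`-coherent, `R` is `n`-regular, and every finitely generated proper ideal of `R`
has a nonzero annihilator. -/
theorem nVonNeumannRegular_iff
    (R : Type) [CommRing R] (n : ℕ) (hn : 1 ≤ n) :
    (∀ (M : Type) [AddCommGroup M] [Module R M],
        IsFinNPresented R n M → Module.Projective R M) ↔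
      (StrongNCoherent R n ∧ NRegular R n ∧
        ∀ I : Ideal R, I.FG → I ≠ ⊤ → ∃ r : R, r ≠ 0 ∧ ∀ x ∈ I, r * x = 0) := by
  constructor
  · intro H
    refine ⟨fun M _ _ hM => ?_, fun M _ _ hM => ?_, aux_ann n H hn⟩
    · haveI := H M hM
      haveI := aux_fin hM
      exact aux_proj_pres _ M
    · haveI := H M hM
      exact aux_res M
  · rintro ⟨ha, hb, hc⟩ M _ _ hM
    obtain ⟨F⟩ := hb M hM
    exact aux_back n hc ha _ M hM (aux_pd_of_res F)
end

section
/- Let n ≥ 1 and let R be a strong n-coherent and n-regular ring. Then every finitely n-presented R-module M admits a finite resolution by finitely generated projective modules: there exist d ≥ 0 and an exact sequence 0 → P_d → P_{d−1} → ⋯ → P_1 → P_0 → M → 0 of R-modules in which every P_i is finitely generated and projective. -/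
/-- A finite resolution `0 → P_d → ⋯ → P_1 → P_0 → M → 0` of `M` by finitely generated
projective `R`-modules, encoded as an infinite exact chain vanishing in degrees `> len`. -/
structure FiniteFGProjResolution (R : Type) [Ring R] (M : Type) [AddCommGroup M]
    [Module R M] : Type 1 where
  len : ℕ
  P : ℕ → Type
  [acg : ∀ i, AddCommGroup (P i)]
  [mod : ∀ i, Module R (P i)]
  proj : ∀ i, Module.Projective R (P i)
  fg : ∀ i, Module.Finite R (P i)
  f : ∀ i : ℕ, P (i + 1) →ₗ[R] P i
  g : P 0 →ₗ[R] M
  surj : Function.Surjective g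
  exact0 : LinearMap.ker g = LinearMap.range (f 0)
  exact : ∀ i : ℕ, LinearMap.ker (f i) = LinearMap.range (f (i + 1))
  bounded : ∀ i : ℕ, len < i → ∀ x : P i, x = 0

open CategoryTheory in
theorem aux_kerPD (R : Type) [Ring R] (M P : Type) [AddCommGroup M] [Module R M]
    [AddCommGroup P] [Module R P] (g : P →ₗ[R] M) (hg : Function.Surjective g) :
    ∃ S : ShortComplex (ModuleCat.{0} R), S.ShortExact ∧ S.X₁ = ModuleCat.of R (LinearMap.ker g) ∧
      S.X₂ = ModuleCat.of R P ∧ S.X₃ = ModuleCat.of R M := by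
  refine ⟨ShortComplex.mk (ModuleCat.ofHom (LinearMap.ker g).subtype) (ModuleCat.ofHom g) ?_,
    ?_, rfl, rfl, rfl⟩
  · ext x
    exact x.2
  · refine ShortComplex.ShortExact.mk' ?_ ?_ ?_
    · rw [ShortComplex.moduleCat_exact_iff]
      intro x hx
      exact ⟨⟨x, hx⟩, rfl⟩
    · rw [ModuleCat.mono_iff_injective]
      exact Subtype.val_injective
    · rw [ModuleCat.epi_iff_surjective]
      exact hg

open CategoryTheory in
theorem aux_PD (R : Type) [Ring R] (d : ℕ) : ∀ (M : Type) [AddCommGroup M] [Module R M]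
    (r : FiniteProjResolution R M), r.len ≤ d →
    HasProjectiveDimensionLT (ModuleCat.of R M) (d + 1) := by
  induction d with
  | zero =>
    intro M _ _ r hr
    letI := r.acg
    letI := r.mod
    have hb := r.bounded 1 (by omega)
    have hinj : Function.Injective r.g := by
      rw [← LinearMap.ker_eq_bot, r.exact0, LinearMap.range_eq_bot]
      ext x
      rw [hb x]; simp
    have := r.proj 0
    have : Module.Projective R M :=
      Module.Projective.of_equiv (LinearEquiv.ofBijective r.g ⟨hinj, r.surj⟩)
    have : Projective (ModuleCat.of R M) :=
      (IsProjective.iff_projective (R := R) M).1 this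
    infer_instance
  | succ d ih =>
    intro M _ _ r hr
    letI := r.acg
    letI := r.mod
    have hmem : ∀ x, r.f 0 x ∈ LinearMap.ker r.g := fun x => by
      rw [r.exact0]; exact ⟨x, rfl⟩
    have hK := ih (LinearMap.ker r.g)
      { len := d
        P := fun i => r.P (i + 1)
        proj := fun i => r.proj (i + 1)
        f := fun i => r.f (i + 1)
        g := (r.f 0).codRestrict _ hmem
        surj := by
          rintro ⟨y, hy⟩
          have hy' := hy
          rw [r.exact0] at hy'
          obtain ⟨x, hx⟩ := hy'
          exact ⟨x, Subtype.ext hx⟩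
        exact0 := by rw [LinearMap.ker_codRestrict]; exact r.exact 0
        exact := fun i => r.exact (i + 1)
        bounded := fun i hi => r.bounded (i + 1) (by omega) } le_rfl
    obtain ⟨S, hS, h1, h2, h3⟩ := aux_kerPD R M (r.P 0) r.g r.surj
    rw [← h3]
    have hp : Projective (ModuleCat.of R (r.P 0)) :=
      (IsProjective.iff_projective (R := R) (r.P 0)).1 (r.proj 0)
    refine hS.hasProjectiveDimensionLT_X₃ (n := d + 1) (by rw [h1]; exact hK) ?_
    rw [h2]
    exact hasProjectiveDimensionLT_of_ge _ 1 _ (by omega)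

theorem aux_splice (R : Type) [Ring R] (M P : Type) [AddCommGroup M] [Module R M]
    [AddCommGroup P] [Module R P] [hp : Module.Projective R P] [hf : Module.Finite R P]
    (g : P →ₗ[R] M) (hg : Function.Surjective g)
    (h : Nonempty (FiniteFGProjResolution R (LinearMap.ker g))) :
    Nonempty (FiniteFGProjResolution R M) := by
  obtain ⟨r⟩ := h
  letI := r.acg
  letI := r.mod
  let Q : ℕ → Type := fun i => match i with
    | 0 => P
    | i + 1 => r.P i
  letI iA : ∀ i, AddCommGroup (Q i) := fun i => match i with
    | 0 => inferInstanceAs (AddCommGroup P)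
    | i + 1 => inferInstanceAs (AddCommGroup (r.P i))
  letI iM : ∀ i, Module R (Q i) := fun i => match i with
    | 0 => inferInstanceAs (Module R P)
    | i + 1 => inferInstanceAs (Module R (r.P i))
  let F : ∀ i : ℕ, Q (i + 1) →ₗ[R] Q i := fun i => match i with
    | 0 => (LinearMap.ker g).subtype ∘ₗ r.g
    | i + 1 => r.f i
  exact ⟨{
    len := r.len + 1
    P := Q
    acg := iA
    mod := iM
    proj := fun i => match i with
      | 0 => hp
      | i + 1 => r.proj i
    fg := fun i => match i with
      | 0 => hf
      | i + 1 => r.fg i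
    f := F
    g := g
    surj := hg
    exact0 := by
      change LinearMap.ker g = LinearMap.range ((LinearMap.ker g).subtype ∘ₗ r.g)
      rw [LinearMap.range_comp, LinearMap.range_eq_top.2 r.surj, Submodule.map_top,
        Submodule.range_subtype]
    exact := fun i => match i with
      | 0 => by
        change LinearMap.ker ((LinearMap.ker g).subtype ∘ₗ r.g) = LinearMap.range (r.f 0)
        rw [LinearMap.ker_comp, Submodule.ker_subtype, Submodule.comap_bot, r.exact0]
      | i + 1 => r.exact i
    bounded := fun i hi => match i, hi with
      | 0, hi => absurd hi (by omega)
      | i + 1, hi => r.bounded i (by omega) }⟩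

theorem aux_zero_s8 (R : Type) [Ring R] (M : Type) [AddCommGroup M] [Module R M]
    [Subsingleton M] : Nonempty (FiniteFGProjResolution R M) :=
  ⟨{ len := 0
     P := fun _ => PUnit
     proj := fun _ => inferInstance
     fg := fun _ => inferInstance
     f := fun _ => 0
     g := 0
     surj := fun y => ⟨0, Subsingleton.elim _ _⟩
     exact0 := Subsingleton.elim _ _
     exact := fun _ => Subsingleton.elim _ _
     bounded := fun _ _ _ => Subsingleton.elim _ _ }⟩

open CategoryTheory in
theorem aux_main (R : Type) [Ring R] (n : ℕ) (hcoh : StrongNCoherent R n) (d : ℕ) :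
    ∀ (M : Type) [AddCommGroup M] [Module R M], IsFinNPresented R n M →
    HasProjectiveDimensionLT (ModuleCat.of R M) (d + 1) →
    Nonempty (FiniteFGProjResolution R M) := by
  induction d with
  | zero =>
    intro M _ _ hM hd
    obtain ⟨k, f, g, hg, -⟩ := hM
    have : Module.Finite R M := Module.Finite.of_surjective g hg
    have : Module.Projective R M :=
      (IsProjective.iff_projective (R := R) M).2
        (projective_iff_hasProjectiveDimensionLT_one.2 hd)
    have : Subsingleton (LinearMap.ker (LinearMap.id : M →ₗ[R] M)) := by
      rw [LinearMap.ker_id]; infer_instance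
    exact aux_splice R M M LinearMap.id Function.surjective_id (aux_zero_s8 R _)
  | succ d ih =>
    intro M _ _ hM hd
    obtain ⟨k, f, g, hg, h0, h⟩ := hcoh M hM
    have h0 := h0 (by omega)
    have hmem : ∀ x, f 0 x ∈ LinearMap.ker g := fun x => by
      rw [h0]; exact ⟨x, rfl⟩
    refine aux_splice R M (Fin (k 0) → R) g hg (ih _ ?_ ?_)
    · refine ⟨fun i => k (i + 1), fun i => f (i + 1), (f 0).codRestrict _ hmem, ?_, ?_, ?_⟩
      · rintro ⟨y, hy⟩
        have hy' := hy
        rw [h0] at hy'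
        obtain ⟨x, hx⟩ := hy'
        exact ⟨x, Subtype.ext hx⟩
      · intro hn
        rw [LinearMap.ker_codRestrict]; exact h 0 (by omega)
      · intro i hi
        exact h (i + 1) (by omega)
    · obtain ⟨S, hS, h1, h2, h3⟩ := aux_kerPD R M _ g hg
      rw [← h1]
      have hp : Projective (ModuleCat.of R (Fin (k 0) → R)) :=
        (IsProjective.iff_projective (R := R) (Fin (k 0) → R)).1 inferInstance
      refine hS.hasProjectiveDimensionLT_X₁ (n := d + 1) ?_ (by rw [h3]; exact hd)
      rw [h2]
      exact hasProjectiveDimensionLT_of_ge _ 1 _ (by omega)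

/-- Let `n ≥ 1` and let `R` be a strong `n`-coherent and `n`-regular ring.
Then every finitely `n`-presented `R`-module admits a finite resolution
`0 → P_d → ⋯ → P_0 → M → 0` by finitely generated projective modules. -/
theorem finNPresented_has_finite_fg_proj_resolution
    (R : Type) [Ring R] (n : ℕ) (hn : 1 ≤ n)
    (hcoh : StrongNCoherent R n) (hreg : NRegular R n)
    (M : Type) [AddCommGroup M] [Module R M] (hM : IsFinNPresented R n M) :
    Nonempty (FiniteFGProjResolution R M) := by
  obtain ⟨r⟩ := hreg M hM
  exact aux_main R n hcoh r.len M hM (aux_PD R r.len M r le_rfl)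
end

section
/- Let R be a ring, let M be a finitely presented R-module and let α : M → M be a nilpotent R-linear endomorphism (α^{k+1} = 0 for some k ≥ 0). Then there exist a finitely generated projective R-module P, a nilpotent R-linear endomorphism β : P → P, and a surjective R-linear map φ : P → M such that φ ∘ β = α ∘ φ. (Explicitly, one may take P = Q^{k+1} for any finitely generated free module Q with a surjection f : Q → M, β the shift (x_0,…,x_k) ↦ (0, x_0, …, x_{k−1}), and φ(x_0,…,x_k) = f(x_0) + α(f(x_1)) + ⋯ + α^k(f(x_k)).) -/
/-- A lift of `(M, α)` to a pair `(P, β)` with `P` finitely generated projective and `β`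
nilpotent, together with a surjection `φ : P ↠ M` intertwining `β` and `α`. -/
structure NilLift (R : Type) [Ring R] (M : Type) [AddCommGroup M] [Module R M]
    (α : Module.End R M) : Type 1 where
  P : Type
  [acg : AddCommGroup P]
  [mod : Module R P]
  proj : Module.Projective R P
  fg : Module.Finite R P
  β : Module.End R P
  nilβ : ∃ m : ℕ, 1 ≤ m ∧ β ^ m = 0
  φ : P →ₗ[R] M
  surj : Function.Surjective φ
  comm : φ ∘ₗ β = α ∘ₗ φ

/-- Let `R` be a ring, `M` a finitely presented `R`-module and
`α : M → M` a nilpotent `R`-linear endomorphism (`α ^ (k+1) = 0` for some `k ≥ 0`).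
Then there exist a finitely generated projective `R`-module `P`, a nilpotent `R`-linear
endomorphism `β : P → P` and a surjective `R`-linear map `φ : P → M` with
`φ ∘ β = α ∘ φ`. -/
theorem exists_nilLift_of_finitePresented
    (R : Type) [Ring R] (M : Type) [AddCommGroup M] [Module R M]
    (hM : IsFinNPresented R 1 M)
    (α : Module.End R M) (k : ℕ) (hα : α ^ (k + 1) = 0) :
    Nonempty (NilLift R M α) := by
  obtain ⟨n, -, g, hg, -, -⟩ := hM
  let Q := Fin (n 0) → R
  let β : Module.End R (Fin (k + 1) → Q) :=
    LinearMap.pi (Fin.cases 0 (fun j : Fin k => LinearMap.proj j.castSucc))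
  have β0 : ∀ x, β x 0 = 0 := fun x => rfl
  have βs : ∀ x (j : Fin k), β x j.succ = x j.castSucc := fun x j => rfl
  let φ : (Fin (k + 1) → Q) →ₗ[R] M :=
    ∑ i : Fin (k + 1), (α ^ (i : ℕ)) ∘ₗ g ∘ₗ LinearMap.proj i
  have φa : ∀ x, φ x = ∑ i : Fin (k + 1), (α ^ (i : ℕ)) (g (x i)) := by
    intro x
    simp [φ]
  have hnil : ∀ (m : ℕ) (x : Fin (k + 1) → Q) (i : Fin (k + 1)), (i : ℕ) < m →
      (β ^ m) x i = 0 := by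
    intro m
    induction m with
    | zero => intro x i hi; omega
    | succ m ih =>
      intro x i hi
      rw [pow_succ', Module.End.mul_apply]
      induction i using Fin.cases with
      | zero => exact β0 _
      | succ j =>
        rw [βs]
        apply ih
        simp at hi ⊢
        omega
  refine ⟨{ P := Fin (k + 1) → Q, proj := inferInstance, fg := inferInstance, β := β,
            nilβ := ⟨k + 1, by omega, ?_⟩, φ := φ, surj := ?_, comm := ?_ }⟩
  · refine LinearMap.ext fun x => funext fun i => hnil _ x i i.2
  · intro y
    obtain ⟨q, rfl⟩ := hg y
    refine ⟨Pi.single 0 q, ?_⟩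
    rw [φa, Fin.sum_univ_succ]
    simp
  · refine LinearMap.ext fun x => ?_
    rw [LinearMap.comp_apply, LinearMap.comp_apply, φa, φa, Fin.sum_univ_succ,
      Fin.sum_univ_castSucc, map_add, map_sum, β0]
    have h : α ((α ^ k) (g (x (Fin.last k)))) = 0 := by
      rw [← Module.End.mul_apply, ← pow_succ', hα]; rfl
    simp only [map_zero, zero_add, Fin.val_last, h, add_zero, βs, Fin.val_succ,
      Fin.val_castSucc, pow_succ', Module.End.mul_apply]
end

section
/- Let n ≥ 1 and let R be a strong n-coherent and n-regular ring. Let M be a finitely n-presented R-module and α : M → M a nilpotent R-linear endomorphism. Then the pair (M, α) admits a finite resolution in the category of pairs (finitely generated projective module, nilpotent endomorphism): there exist k ≥ 0, finitely generated projective R-modules P_0, …, P_k, nilpotent R-linear endomorphisms β_i : P_i → P_i, and R-linear maps forming an exact sequence 0 → P_k → ⋯ → P_1 → P_0 → M → 0 such that every map in the sequence intertwines the endomorphisms (each d_i : P_i → P_{i−1} satisfies d_i ∘ β_i = β_{i−1} ∘ d_i, and the augmentation φ_0 : P_0 → M satisfies φ_0 ∘ β_0 = α ∘ φ_0). -/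
/-- A finite resolution `0 → (P_k, β_k) → ⋯ → (P_0, β_0) → (M, α) → 0` of the pair
`(M, α)` in the category of pairs (module, nilpotent endomorphism), where each `P_i` is
finitely generated projective, each `β_i` is nilpotent, all the maps of the resolution
intertwine the endomorphisms, and the resolution is exact. It is encoded as an infinite
exact chain vanishing in degrees `> len`. -/
structure NilFGProjResolution (R : Type) [Ring R] (M : Type) [AddCommGroup M]
    [Module R M] (α : Module.End R M) : Type 1 where
  len : ℕ
  P : ℕ → Type
  [acg : ∀ i, AddCommGroup (P i)]
  [mod : ∀ i, Module R (P i)]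
  proj : ∀ i, Module.Projective R (P i)
  fg : ∀ i, Module.Finite R (P i)
  β : ∀ i, Module.End R (P i)
  nilβ : ∀ i, ∃ m : ℕ, 1 ≤ m ∧ β i ^ m = 0
  f : ∀ i : ℕ, P (i + 1) →ₗ[R] P i
  g : P 0 →ₗ[R] M
  commg : g ∘ₗ β 0 = α ∘ₗ g
  commf : ∀ i : ℕ, f i ∘ₗ β (i + 1) = β i ∘ₗ f i
  surj : Function.Surjective g
  exact0 : LinearMap.ker g = LinearMap.range (f 0)
  exact : ∀ i : ℕ, LinearMap.ker (f i) = LinearMap.range (f (i + 1))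
  bounded : ∀ i : ℕ, len < i → ∀ x : P i, x = 0

section NilHelpers

theorem finNPres_succ_dest {R : Type} [Ring R] {n : ℕ} {M : Type} [AddCommGroup M] [Module R M]
    (h : IsFinNPresented R (n + 1) M) :
    ∃ (k : ℕ) (g : (Fin k → R) →ₗ[R] M), Function.Surjective g ∧
      IsFinNPresented R n (LinearMap.ker g) := by
  obtain ⟨k, f, g, hg, h0, hi⟩ := h
  have h0' := h0 (Nat.succ_pos n)
  refine ⟨k 0, g, hg, fun i => k (i + 1), fun i => f (i + 1),
    (f 0).codRestrict (LinearMap.ker g) (fun x => by rw [h0']; exact ⟨x, rfl⟩), ?_, ?_, ?_⟩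
  · rintro ⟨y, hy⟩
    rw [h0'] at hy
    obtain ⟨x, rfl⟩ := hy
    exact ⟨x, rfl⟩
  · intro hn
    rw [LinearMap.ker_codRestrict]
    exact hi 0 (by omega)
  · intro i h
    exact hi (i + 1) (by omega)

theorem finNPres_succ_mk {R : Type} [Ring R] {n : ℕ} {M : Type} [AddCommGroup M] [Module R M]
    {k : ℕ} (g : (Fin k → R) →ₗ[R] M) (hg : Function.Surjective g)
    (h : IsFinNPresented R n (LinearMap.ker g)) : IsFinNPresented R (n + 1) M := by
  obtain ⟨k', f', g', hg', h0, hi⟩ := h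
  refine ⟨fun i => Nat.casesOn i k k',
    fun i => match i with
      | 0 => (LinearMap.ker g).subtype ∘ₗ g'
      | i + 1 => f' i, g, hg, ?_, ?_⟩
  · intro _
    change LinearMap.ker g = LinearMap.range ((LinearMap.ker g).subtype ∘ₗ g')
    rw [LinearMap.range_comp, LinearMap.range_eq_top.2 hg', Submodule.map_top,
      Submodule.range_subtype]
  · intro i h
    cases i with
    | zero =>
      change LinearMap.ker ((LinearMap.ker g).subtype ∘ₗ g') = LinearMap.range (f' 0)
      rw [LinearMap.ker_comp_of_ker_eq_bot _ (Submodule.ker_subtype _)]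
      exact h0 (by omega)
    | succ i =>
      exact hi i (by omega)

theorem finNPres_equiv {R : Type} [Ring R] {n : ℕ} {M N : Type} [AddCommGroup M] [Module R M]
    [AddCommGroup N] [Module R N] (e : M ≃ₗ[R] N) (h : IsFinNPresented R n M) :
    IsFinNPresented R n N := by
  obtain ⟨k, f, g, hg, h0, hi⟩ := h
  refine ⟨k, f, e.toLinearMap ∘ₗ g, e.surjective.comp hg, ?_, hi⟩
  intro hn
  rw [LinearMap.ker_comp_of_ker_eq_bot _ e.ker]
  exact h0 hn

theorem finNPres_finite {R : Type} [Ring R] {n : ℕ} {M : Type} [AddCommGroup M] [Module R M]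
    (h : IsFinNPresented R n M) : Module.Finite R M := by
  obtain ⟨k, f, g, hg, -⟩ := h
  exact Module.Finite.of_surjective g hg

theorem finNPres_succ_mk' {R : Type} [Ring R] {n : ℕ} {M G L : Type} [AddCommGroup M] [Module R M]
    [AddCommGroup G] [Module R G] [Module.Free R G] [Module.Finite R G]
    [AddCommGroup L] [Module R L]
    (g : G →ₗ[R] M) (hg : Function.Surjective g)
    (e : L ≃ₗ[R] LinearMap.ker g) (h : IsFinNPresented R n L) :
    IsFinNPresented R (n + 1) M := by
  let b := (Module.Free.chooseBasis R G).reindex (Fintype.equivFin _)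
  let ε := b.equivFun
  refine finNPres_succ_mk (g ∘ₗ ε.symm.toLinearMap) (hg.comp ε.symm.surjective) ?_
  have hk : (LinearMap.ker g).map ε.toLinearMap = LinearMap.ker (g ∘ₗ ε.symm.toLinearMap) := by
    rw [LinearMap.ker_comp]
    exact Submodule.map_equiv_eq_comap_symm ε _
  exact finNPres_equiv (e.trans ((ε.submoduleMap (LinearMap.ker g)).trans
    (LinearEquiv.ofEq _ _ hk))) h

open CategoryTheory in
theorem nil_shortExact {R : Type} [Ring R] {P M : Type} [AddCommGroup M] [Module R M]
    [AddCommGroup P] [Module R P] (g : P →ₗ[R] M) (hg : Function.Surjective g) :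
    (ShortComplex.mk (ModuleCat.ofHom (LinearMap.ker g).subtype) (ModuleCat.ofHom g)
      (by ext x; exact x.2)).ShortExact where
  exact := by
    rw [CategoryTheory.ShortComplex.ShortExact.moduleCat_exact_iff_function_exact]
    exact LinearMap.exact_subtype_ker_map g
  mono_f := (ModuleCat.mono_iff_injective _).2 Subtype.val_injective
  epi_g := (ModuleCat.epi_iff_surjective _).2 hg

open CategoryTheory in
theorem nil_pd_iff {R : Type} [Ring R] {P M : Type} [AddCommGroup M] [Module R M]
    [AddCommGroup P] [Module R P] [Module.Projective R P] (g : P →ₗ[R] M)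
    (hg : Function.Surjective g) (d : ℕ) :
    HasProjectiveDimensionLT (ModuleCat.of R M) (d + 2) ↔
    HasProjectiveDimensionLT (ModuleCat.of R (LinearMap.ker g)) (d + 1) :=
  (nil_shortExact g hg).hasProjectiveDimensionLT_X₃_iff d
    ((IsProjective.iff_projective P).1 inferInstance)

open CategoryTheory in
theorem nil_pd_of_res {R : Type} [Ring R] (d : ℕ) : ∀ {M : Type} [AddCommGroup M] [Module R M]
    (S : FiniteProjResolution R M), S.len = d →
    HasProjectiveDimensionLT (ModuleCat.of R M) (d + 1) := by
  induction d with
  | zero =>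
    intro M _ _ S hS
    let := S.acg
    let := S.mod
    have hinj : Function.Injective S.g := by
      rw [← LinearMap.ker_eq_bot, S.exact0, LinearMap.range_eq_bot]
      ext x
      rw [S.bounded 1 (by omega) x, map_zero, map_zero]
    have := S.proj 0
    have : Module.Projective R M :=
      Module.Projective.of_equiv (LinearEquiv.ofBijective S.g ⟨hinj, S.surj⟩)
    exact projective_iff_hasProjectiveDimensionLT_one.1
      ((IsProjective.iff_projective M).1 inferInstance)
  | succ d ih =>
    intro M _ _ S hS
    let := S.acg
    let := S.mod
    have := S.proj 0
    rw [nil_pd_iff S.g S.surj]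
    refine ih (M := LinearMap.ker S.g) 
      { len := d
        P := fun i => S.P (i + 1)
        proj := fun i => S.proj (i + 1)
        f := fun i => S.f (i + 1)
        g := (S.f 0).codRestrict (LinearMap.ker S.g) 
          (fun x => by rw [S.exact0]; exact ⟨x, rfl⟩)
        surj := ?_
        exact0 := ?_
        exact := fun i => S.exact (i + 1)
        bounded := fun i hi => S.bounded (i + 1) (by omega) } rfl
    · rintro ⟨y, hy⟩
      rw [S.exact0] at hy
      obtain ⟨x, rfl⟩ := hy
      exact ⟨x, rfl⟩
    · rw [LinearMap.ker_codRestrict]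
      exact S.exact 0

theorem nilRes_zero {R : Type} [Ring R] {M : Type} [AddCommGroup M] [Module R M]
    [Subsingleton M] (α : Module.End R M) : Nonempty (NilFGProjResolution R M α) :=
  ⟨{ len := 0
     P := fun _ => PUnit
     proj := fun _ => inferInstance
     fg := fun _ => inferInstance
     β := fun _ => 0
     nilβ := fun _ => ⟨1, le_rfl, by simp⟩
     f := fun _ => 0
     g := 0
     commg := by simp
     commf := by simp
     surj := fun x => ⟨0, Subsingleton.elim _ _⟩
     exact0 := Subsingleton.elim _ _
     exact := fun _ => Subsingleton.elim _ _
     bounded := fun _ _ _ => rfl }⟩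

theorem nilRes_cons {R : Type} [Ring R] {M : Type} [AddCommGroup M] [Module R M]
    (α : Module.End R M) {P : Type} [AddCommGroup P] [Module R P] [Module.Projective R P]
    [Module.Finite R P] (β : Module.End R P) (hβ : ∃ m : ℕ, 1 ≤ m ∧ β ^ m = 0)
    (g : P →ₗ[R] M) (hg : Function.Surjective g) (hc : g ∘ₗ β = α ∘ₗ g)
    (γ : Module.End R (LinearMap.ker g)) (hγ : ∀ x, (γ x : P) = β x)
    (h : Nonempty (NilFGProjResolution R (LinearMap.ker g) γ)) :
    Nonempty (NilFGProjResolution R M α) := by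
  obtain ⟨S⟩ := h
  let := S.acg
  let := S.mod
  exact ⟨{
    len := S.len + 1
    P := fun i => Nat.casesOn i P S.P
    acg := fun i => match i with
      | 0 => inferInstanceAs (AddCommGroup P)
      | i + 1 => S.acg i
    mod := fun i => match i with
      | 0 => inferInstanceAs (Module R P)
      | i + 1 => S.mod i
    proj := fun i => match i with
      | 0 => inferInstanceAs (Module.Projective R P)
      | i + 1 => S.proj i
    fg := fun i => match i with
      | 0 => inferInstanceAs (Module.Finite R P)
      | i + 1 => S.fg i
    β := fun i => match i with
      | 0 => β
      | i + 1 => S.β i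
    nilβ := fun i => match i with
      | 0 => hβ
      | i + 1 => S.nilβ i
    f := fun i => match i with
      | 0 => (LinearMap.ker g).subtype ∘ₗ S.g
      | i + 1 => S.f i
    g := g
    commg := hc
    commf := fun i => match i with
      | 0 => by
        refine LinearMap.ext fun x => ?_
        have := LinearMap.congr_fun S.commg x
        change ((S.g (S.β 0 x) : LinearMap.ker g) : P) = β (S.g x)
        rw [← hγ]
        exact congrArg Subtype.val this
      | i + 1 => S.commf i
    surj := hg
    exact0 := by
      change LinearMap.ker g = LinearMap.range ((LinearMap.ker g).subtype ∘ₗ S.g)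
      rw [LinearMap.range_comp, LinearMap.range_eq_top.2 S.surj, Submodule.map_top,
        Submodule.range_subtype]
    exact := fun i => match i with
      | 0 => by
        change LinearMap.ker ((LinearMap.ker g).subtype ∘ₗ S.g) = LinearMap.range (S.f 0)
        rw [LinearMap.ker_comp_of_ker_eq_bot _ (Submodule.ker_subtype _)]
        exact S.exact0
      | i + 1 => S.exact i
    bounded := fun i => match i with
      | 0 => fun h => absurd h (by omega)
      | i + 1 => fun h => S.bounded i (by omega) }⟩

/-- The shift endomorphism of `F^(m+1)`. -/
def nilShift (R F : Type) [Ring R] [AddCommGroup F] [Module R F] (m : ℕ) :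
    Module.End R (Fin (m + 1) → F) where
  toFun x := Fin.cons 0 (fun i : Fin m => x i.castSucc)
  map_add' x y := by
    funext i
    refine Fin.cases ?_ (fun i => ?_) i <;> simp
  map_smul' r x := by
    funext i
    refine Fin.cases ?_ (fun i => ?_) i <;> simp

theorem nilShift_pow (R F : Type) [Ring R] [AddCommGroup F] [Module R F] (m : ℕ) :
    nilShift R F m ^ (m + 1) = 0 := by
  have key : ∀ (j : ℕ) (x : Fin (m + 1) → F) (i : Fin (m + 1)), (i : ℕ) < j →
      ((nilShift R F m ^ j) x) i = 0 := by
    intro j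
    induction j with
    | zero => intro x i h; omega
    | succ j ih =>
      intro x i
      rw [pow_succ', Module.End.mul_apply]
      refine Fin.cases ?_ (fun i => ?_) i
      · intro _; rfl
      · intro h
        exact ih x i.castSucc (by simpa using h)
  refine LinearMap.ext fun x => funext fun i => ?_
  exact key _ _ i i.2

/-- The map `F^(m+1) → M`, `x ↦ ∑ α^i (g x_i)`. -/
def nilCover {R F M : Type} [Ring R] [AddCommGroup F] [Module R F] [AddCommGroup M] [Module R M]
    (m : ℕ) (α : Module.End R M) (g : F →ₗ[R] M) : (Fin (m + 1) → F) →ₗ[R] M :=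
  ∑ i : Fin (m + 1), (α ^ (i : ℕ)) ∘ₗ g ∘ₗ LinearMap.proj i

theorem nilCover_apply {R F M : Type} [Ring R] [AddCommGroup F] [Module R F] [AddCommGroup M]
    [Module R M] (m : ℕ) (α : Module.End R M) (g : F →ₗ[R] M) (x : Fin (m + 1) → F) :
    nilCover m α g x = ∑ i : Fin (m + 1), (α ^ (i : ℕ)) (g (x i)) := by
  simp [nilCover]

theorem nilCover_comm {R F M : Type} [Ring R] [AddCommGroup F] [Module R F] [AddCommGroup M]
    [Module R M] (m : ℕ) (α : Module.End R M) (hα : α ^ (m + 1) = 0) (g : F →ₗ[R] M) :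
    nilCover m α g ∘ₗ nilShift R F m = α ∘ₗ nilCover m α g := by
  refine LinearMap.ext fun x => ?_
  rw [LinearMap.comp_apply, LinearMap.comp_apply, nilCover_apply, nilCover_apply, map_sum,
    Fin.sum_univ_succ, Fin.sum_univ_castSucc]
  have h1 : α ((α ^ ((Fin.last m : Fin (m + 1)) : ℕ)) (g (x (Fin.last m)))) = 0 := by
    rw [← Module.End.mul_apply, ← pow_succ', Fin.val_last, hα]; rfl
  rw [h1, add_zero]
  have h0 : (nilShift R F m x) 0 = 0 := rfl
  rw [h0, map_zero, map_zero, zero_add]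
  refine Finset.sum_congr rfl fun i _ => ?_
  rw [← Module.End.mul_apply, ← pow_succ']
  rfl

theorem nilCover_surj {R F M : Type} [Ring R] [AddCommGroup F] [Module R F] [AddCommGroup M]
    [Module R M] (m : ℕ) (α : Module.End R M) (g : F →ₗ[R] M) (hg : Function.Surjective g) :
    Function.Surjective (nilCover m α g) := by
  intro y
  obtain ⟨x, rfl⟩ := hg y
  refine ⟨Fin.cons x (fun _ => 0), ?_⟩
  rw [nilCover_apply, Fin.sum_univ_succ]
  simp

/-- The parametrization of the kernel of `nilCover`. -/
def nilPar {R F G : Type} [Ring R] [AddCommGroup F] [Module R F] [AddCommGroup G] [Module R G]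
    (m : ℕ) (a : Module.End R F) (f : G →ₗ[R] F) : G × (Fin m → F) →ₗ[R] (Fin (m + 1) → F) where
  toFun x := Fin.cons (f x.1 - ∑ i : Fin m, (a ^ ((i : ℕ) + 1)) (x.2 i)) x.2
  map_add' x y := by
    funext i
    refine Fin.cases ?_ (fun i => ?_) i
    · simp [Finset.sum_add_distrib]; abel
    · simp
  map_smul' r x := by
    funext i
    refine Fin.cases ?_ (fun i => ?_) i
    · simp [smul_sub, Finset.smul_sum]
    · simp

theorem nilCover_ker_pres {R F M G : Type} [Ring R] [AddCommGroup F] [Module R F]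
    [AddCommGroup M] [Module R M] [AddCommGroup G] [Module R G]
    [Module.Free R F] [Module.Finite R F] [Module.Free R G] [Module.Finite R G]
    (m n : ℕ) (α : Module.End R M) (g : F →ₗ[R] M) (hg : Function.Surjective g)
    (f : G →ₗ[R] LinearMap.ker g) (hf : Function.Surjective f)
    (h : IsFinNPresented R n (LinearMap.ker f)) :
    IsFinNPresented R (n + 1) (LinearMap.ker (nilCover m α g)) := by
  obtain ⟨a, ha⟩ := Module.projective_lifting_property g (α ∘ₗ g) hg
  have hap : ∀ (i : ℕ) (x : F), g ((a ^ i) x) = (α ^ i) (g x) := by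
    intro i
    induction i with
    | zero => intro x; rfl
    | succ i ih =>
      intro x
      rw [pow_succ', pow_succ', Module.End.mul_apply, Module.End.mul_apply, ← ih]
      exact LinearMap.congr_fun ha _
  let ψ := nilPar m a ((LinearMap.ker g).subtype ∘ₗ f)
  have hψ0 : ∀ x, ψ x 0 = (f x.1 : F) - ∑ i : Fin m, (a ^ ((i : ℕ) + 1)) (x.2 i) :=
    fun x => rfl
  have hψs : ∀ x (i : Fin m), ψ x i.succ = x.2 i := fun x i => rfl
  have hψ : ∀ x, ψ x ∈ LinearMap.ker (nilCover m α g) := by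
    intro x
    rw [LinearMap.mem_ker, nilCover_apply, Fin.sum_univ_succ, hψ0]
    simp only [hψs, Fin.val_zero, pow_zero, Module.End.one_apply, Fin.val_succ, map_sub, map_sum,
      hap]
    rw [LinearMap.mem_ker.1 (f x.1).2]
    simp
  refine finNPres_succ_mk' (L := LinearMap.ker f) (ψ.codRestrict _ hψ) ?_ ?_ h
  · rintro ⟨y, hy⟩
    have hy' : y 0 + ∑ i : Fin m, (a ^ ((i : ℕ) + 1)) (y i.succ) ∈ LinearMap.ker g := by
      rw [LinearMap.mem_ker, nilCover_apply, Fin.sum_univ_succ] at hy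
      rw [LinearMap.mem_ker, map_add, map_sum]
      simpa [hap] using hy
    obtain ⟨u, hu⟩ := hf ⟨_, hy'⟩
    refine ⟨(u, fun i => y i.succ), Subtype.ext ?_⟩
    funext i
    refine Fin.cases ?_ (fun i => ?_) i
    · change ψ _ 0 = y 0
      rw [hψ0, hu]
      simp
    · rfl
  · have hk : ∀ x : LinearMap.ker (ψ.codRestrict _ hψ), x.1.2 = 0 ∧ f x.1.1 = 0 := by
      rintro ⟨x, hx⟩
      rw [LinearMap.ker_codRestrict, LinearMap.mem_ker] at hx
      have h2 : x.2 = 0 := by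
        funext i
        rw [← hψs x i, hx]; rfl
      refine ⟨h2, Subtype.ext ?_⟩
      have := hψ0 x
      rw [hx, h2] at this
      simpa using this.symm
    exact
      { toFun := fun u => ⟨(u.1, 0), by
          rw [LinearMap.ker_codRestrict, LinearMap.mem_ker]
          funext i
          refine Fin.cases ?_ (fun i => ?_) i
          · rw [hψ0]
            simp
          · rfl⟩
        map_add' := fun u v => by
          apply Subtype.ext
          simp
        map_smul' := fun r u => by
          apply Subtype.ext
          simp
        invFun := fun x => ⟨x.1.1, (hk x).2⟩
        left_inv := fun u => rfl
        right_inv := fun x => Subtype.ext (Prod.ext rfl (hk x).1.symm) }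

open CategoryTheory in
theorem nilRes_of_pd (R : Type) [Ring R] (n : ℕ) (hcoh : StrongNCoherent R (n + 1)) (d : ℕ) :
    ∀ (M : Type) [AddCommGroup M] [Module R M], IsFinNPresented R (n + 1) M →
    HasProjectiveDimensionLT (ModuleCat.of R M) (d + 1) →
    ∀ (α : Module.End R M), (∃ m : ℕ, 1 ≤ m ∧ α ^ m = 0) →
    Nonempty (NilFGProjResolution R M α) := by
  induction d with
  | zero =>
    intro M _ _ hM hd α hα
    have : Module.Projective R M := (IsProjective.iff_projective M).2
      (projective_iff_hasProjectiveDimensionLT_one.2 hd)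
    have := finNPres_finite hM
    have : Subsingleton (LinearMap.ker (LinearMap.id : M →ₗ[R] M)) := by
      rw [LinearMap.ker_id]; infer_instance
    exact nilRes_cons α α hα LinearMap.id Function.surjective_id rfl LinearMap.id
      (fun x => by
        have hx : x = 0 := Subsingleton.elim x 0
        subst hx
        exact (map_zero α).symm) (nilRes_zero _)
  | succ d ih =>
    intro M _ _ hM hd α hα
    obtain ⟨k, g, hg, hK⟩ := finNPres_succ_dest (hcoh M hM)
    obtain ⟨l, f, hf, hL⟩ := finNPres_succ_dest hK
    obtain ⟨m, hm, hα⟩ := hα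
    obtain ⟨m, rfl⟩ : ∃ m', m = m' + 1 := ⟨m - 1, by omega⟩
    have hc := nilCover_comm m α hα g
    have hs := nilCover_surj m α g hg
    have hmaps : ∀ x ∈ LinearMap.ker (nilCover m α g),
        nilShift R _ m x ∈ LinearMap.ker (nilCover m α g) := by
      intro x hx
      have := LinearMap.congr_fun hc x
      rw [LinearMap.mem_ker] at hx ⊢
      rw [LinearMap.comp_apply, LinearMap.comp_apply, hx, map_zero] at this
      exact this
    refine nilRes_cons α (nilShift R _ m) ⟨m + 1, hm, nilShift_pow R _ m⟩ _ hs hc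
      ((nilShift R _ m).restrict hmaps) (fun x => rfl) ?_
    refine ih _ (nilCover_ker_pres m n α g hg f hf hL) ((nil_pd_iff _ hs d).1 hd) _
      ⟨m + 1, hm, ?_⟩
    rw [Module.End.pow_restrict]
    refine LinearMap.ext fun x => Subtype.ext ?_
    rw [LinearMap.restrict_apply]
    simp [nilShift_pow]

end NilHelpers

/-- Let `n ≥ 1` and let `R` be a strong `n`-coherent and `n`-regular ring.
If `M` is a finitely `n`-presented `R`-module and `α : M → M` is a nilpotent `R`-linear
endomorphism, then the pair `(M, α)` admits a finite resolution by pairs consisting of a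
finitely generated projective module with a nilpotent endomorphism, all maps
intertwining the endomorphisms. -/
theorem exists_nil_resolution
    (R : Type) [Ring R] (n : ℕ) (hn : 1 ≤ n)
    (hcoh : StrongNCoherent R n) (hreg : NRegular R n)
    (M : Type) [AddCommGroup M] [Module R M] (hM : IsFinNPresented R n M)
    (α : Module.End R M) (hα : ∃ m : ℕ, 1 ≤ m ∧ α ^ m = 0) :
    Nonempty (NilFGProjResolution R M α) := by
  obtain ⟨n, rfl⟩ : ∃ n', n = n' + 1 := ⟨n - 1, by omega⟩
  obtain ⟨S⟩ := hreg M hM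
  exact nilRes_of_pd R n hcoh S.len M hM (nil_pd_of_res _ S rfl) α hα
end

section
/- A ring R is coherent if and only if every finitely presented R-module is finitely ∞-presented, i.e. every finitely presented R-module admits a resolution ⋯ → F_1 → F_0 → M → 0 by finitely generated free modules. -/
/-- A ring `R` is coherent if every finitely generated left ideal of `R` is finitely
presented as an `R`-module. -/
def IsCoherentRing (R : Type) [Ring R] : Prop :=
  ∀ I : Ideal R, I.FG → IsFinNPresented R 1 I


theorem aux_fg_range {R : Type} [Ring R] {n : ℕ} (N : Submodule R (Fin n → R)) (h : N.FG) :
    ∃ (m : ℕ) (f : (Fin m → R) →ₗ[R] (Fin n → R)), N = LinearMap.range f := by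
  have : Module.Finite R N := Module.Finite.iff_fg.mpr h
  obtain ⟨m, f, hf⟩ := Module.Finite.exists_fin' R N
  refine ⟨m, N.subtype.comp f, ?_⟩
  rw [LinearMap.range_comp, LinearMap.range_eq_top.mpr hf, Submodule.map_top,
    Submodule.range_subtype]

theorem aux_range_fg {R : Type} [Ring R] {M : Type} [AddCommGroup M] [Module R M] {m : ℕ}
    (f : (Fin m → R) →ₗ[R] M) : (LinearMap.range f).FG := by
  rw [LinearMap.range_eq_map]
  exact Submodule.FG.map _ (Module.Finite.fg_top)

theorem aux_toFP {R : Type} [Ring R] {M : Type} [AddCommGroup M] [Module R M]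
    (h : IsFinNPresented R 1 M) : Module.FinitePresentation R M := by
  obtain ⟨k, f, g, hg, h0, -⟩ := h
  refine Module.finitePresentation_of_surjective g hg ?_
  rw [h0 one_pos]
  exact aux_range_fg _

theorem aux_ofFP {R : Type} [Ring R] {M : Type} [AddCommGroup M] [Module R M]
    (h : Module.FinitePresentation R M) : IsFinNPresented R 1 M := by
  obtain ⟨n, g, hg⟩ := Module.Finite.exists_fin' R M
  obtain ⟨m, f, hf⟩ := aux_fg_range _ (Module.FinitePresentation.fg_ker g hg)
  let k : ℕ → ℕ := fun i => Nat.casesOn i n (fun _ => m)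
  refine ⟨k, fun i => Nat.casesOn i f (fun _ => (0 : (Fin m → R) →ₗ[R] (Fin m → R))), g, hg,
    fun _ => hf, fun i hi => absurd hi (by omega)⟩

theorem aux_step {R : Type} [Ring R] (hR : IsCoherentRing R) (n : ℕ)
    (ih : ∀ N : Submodule R (Fin n → R), N.FG → Module.FinitePresentation R N)
    {N : Type} [AddCommGroup N] [Module R N] [Module.Finite R N] (p : N →ₗ[R] R)
    (t : N →ₗ[R] (Fin n → R)) (hinj : ∀ x, p x = 0 → t x = 0 → x = 0) :
    Module.FinitePresentation R N := by
  have hp : (LinearMap.range p).FG := by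
    rw [LinearMap.range_eq_map]
    exact Submodule.FG.map _ (Module.Finite.fg_top)
  have : Module.FinitePresentation R (LinearMap.range p) := aux_toFP (hR _ hp)
  have hk : (LinearMap.ker p.rangeRestrict).FG :=
    Module.FinitePresentation.fg_ker _ p.surjective_rangeRestrict
  have : Module.Finite R (LinearMap.ker p.rangeRestrict) := Module.Finite.iff_fg.mpr hk
  let q : LinearMap.ker p.rangeRestrict →ₗ[R] (Fin n → R) := t.comp (Submodule.subtype _)
  have hq : Function.Injective q := by
    rw [injective_iff_map_eq_zero]
    rintro ⟨x, hx'⟩ h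
    rw [LinearMap.ker_rangeRestrict] at hx'
    exact Subtype.ext (hinj x hx' h)
  have hqr : (LinearMap.range q).FG := by
    rw [LinearMap.range_eq_map]
    exact Submodule.FG.map _ (Module.Finite.fg_top)
  have := ih _ hqr
  have : Module.FinitePresentation R (LinearMap.ker p.rangeRestrict) :=
    Module.FinitePresentation.of_equiv (LinearEquiv.ofInjective q hq).symm
  exact Module.finitePresentation_of_ker p.rangeRestrict p.surjective_rangeRestrict

theorem aux_sub {R : Type} [Ring R] (hR : IsCoherentRing R) (n : ℕ) :
    ∀ N : Submodule R (Fin n → R), N.FG → Module.FinitePresentation R N := by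
  induction n with
  | zero => intro N _; infer_instance
  | succ n ih =>
    intro N hN
    have : Module.Finite R N := Module.Finite.iff_fg.mpr hN
    refine aux_step hR n ih ((LinearMap.proj 0).comp N.subtype)
      ((LinearMap.funLeft R R Fin.succ).comp N.subtype) ?_
    rintro ⟨x, hx⟩ h0 h
    have h1 : ∀ i : Fin n, x i.succ = 0 := fun i => congrFun h i
    apply Subtype.ext
    funext i
    exact Fin.cases h0 h1 i

theorem aux_ker {R : Type} [Ring R] (hR : IsCoherentRing R) {a b : ℕ}
    (f : (Fin a → R) →ₗ[R] (Fin b → R)) :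
    ∃ (m : ℕ) (g : (Fin m → R) →ₗ[R] (Fin a → R)), LinearMap.ker f = LinearMap.range g := by
  have := aux_sub hR b _ (aux_range_fg f)
  have := Module.FinitePresentation.fg_ker _ f.surjective_rangeRestrict
  rw [LinearMap.ker_rangeRestrict] at this
  exact aux_fg_range _ this

theorem aux_forward {R : Type} [Ring R] (hR : IsCoherentRing R) {M : Type} [AddCommGroup M]
    [Module R M] (h : IsFinNPresented R 1 M) : IsFinInfPresented R M := by
  obtain ⟨k, f, g, hg, h0, -⟩ := h
  choose m d hd using fun (s : Σ a : ℕ, Σ b : ℕ, ((Fin a → R) →ₗ[R] (Fin b → R))) =>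
    aux_ker hR s.2.2
  let s : ℕ → Σ a : ℕ, Σ b : ℕ, ((Fin a → R) →ₗ[R] (Fin b → R)) := fun i =>
    Nat.rec ⟨k 1, k 0, f 0⟩ (fun _ t => ⟨m t, t.1, d t⟩) i
  exact ⟨fun i => (s i).2.1, fun i => (s i).2.2, g, hg, h0 one_pos, fun i => hd (s i)⟩

theorem aux_backward {R : Type} [Ring R] (I : Ideal R) (h : IsFinInfPresented R (R ⧸ I)) :
    Module.FinitePresentation R I := by
  obtain ⟨k, f, g, hg, h0, h1⟩ := h
  have : Module.FinitePresentation R (LinearMap.range (f 0)) := by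
    refine Module.finitePresentation_of_surjective _ (f 0).surjective_rangeRestrict ?_
    rw [LinearMap.ker_rangeRestrict, h1 0]
    exact aux_range_fg _
  have : Module.FinitePresentation R (LinearMap.ker g) := by rw [h0]; infer_instance
  let π : R →ₗ[R] (R ⧸ I) := I.mkQ
  obtain ⟨φ, hφ⟩ := Module.projective_lifting_property π g I.mkQ_surjective
  obtain ⟨s, hs⟩ := Module.projective_lifting_property g π hg
  have hφ' : ∀ x, π (φ x) = g x := fun x => LinearMap.congr_fun hφ x
  have hs' : ∀ x, g (s x) = π x := fun x => LinearMap.congr_fun hs x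
  let K := LinearMap.ker g
  let u : (K × R) →ₗ[R] R := LinearMap.snd R K R -
    φ.comp (K.subtype.comp (LinearMap.fst R K R) + s.comp (LinearMap.snd R K R))
  have hu : ∀ x, u x = x.2 - φ ((x.1 : Fin (k 0) → R) + s x.2) := fun _ => rfl
  have huI : ∀ x, u x ∈ I := by
    intro x
    have : π (u x) = 0 := by
      have hx : g (x.1 : Fin (k 0) → R) = 0 := x.1.2
      rw [hu, map_sub, hφ', map_add, hs', hx, zero_add, sub_self]
    exact (Submodule.Quotient.mk_eq_zero I).mp this
  refine Module.finitePresentation_of_surjective (u.codRestrict I huI) ?_ ?_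
  · rintro ⟨i, hi⟩
    have hi' : π i = 0 := (Submodule.Quotient.mk_eq_zero I).mpr hi
    refine ⟨(⟨-s i, ?_⟩, i), ?_⟩
    · change g (-s i) = 0
      rw [map_neg, hs', hi', neg_zero]
    · apply Subtype.ext
      change i - φ (-s i + s i) = i
      simp
  · rw [LinearMap.ker_codRestrict]
    have hv : ∀ x, (LinearMap.id - s.comp φ : (Fin (k 0) → R) →ₗ[R] (Fin (k 0) → R)) x ∈ K := by
      intro x
      change g (x - s (φ x)) = 0
      rw [map_sub, hs', hφ', sub_self]
    let v : (Fin (k 0) → R) →ₗ[R] K × R :=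
      LinearMap.prod ((LinearMap.id - s.comp φ : (Fin (k 0) → R) →ₗ[R] (Fin (k 0) → R)).codRestrict K hv) φ
    have : LinearMap.ker u = LinearMap.range v := by
      apply le_antisymm
      · rintro ⟨x, r⟩ hx
        have hx' : r = φ ((x : Fin (k 0) → R) + s r) := sub_eq_zero.mp hx
        refine ⟨(x : Fin (k 0) → R) + s r, ?_⟩
        refine Prod.ext (Subtype.ext ?_) hx'.symm
        change (x : Fin (k 0) → R) + s r - s (φ ((x : Fin (k 0) → R) + s r)) = x
        rw [← hx', add_sub_cancel_right]
      · rintro _ ⟨x, rfl⟩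
        change φ x - φ (x - s (φ x) + s (φ x)) = 0
        rw [sub_add_cancel, sub_self]
    rw [this]
    exact aux_range_fg v

/-- A ring `R` is coherent if and only if every finitely presented
`R`-module is finitely `∞`-presented, i.e. admits a resolution by finitely generated
free modules. -/
theorem coherent_iff_finPresented_finInfPresented (R : Type) [Ring R] :
    IsCoherentRing R ↔
      ∀ (M : Type) [AddCommGroup M] [Module R M],
        IsFinNPresented R 1 M → IsFinInfPresented R M := by
  constructor
  · intro hR M _ _ h
    exact aux_forward hR h
  · intro h I hI
    refine aux_ofFP (aux_backward I (h _ (aux_ofFP ?_)))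
    refine Module.finitePresentation_of_surjective I.mkQ I.mkQ_surjective ?_
    rwa [Submodule.ker_mkQ]
end

section
/- Let R be a commutative arithmetic ring. Then R is coherent if and only if the annihilator of every element of R is a finitely generated ideal, i.e. for every r ∈ R the ideal Ann(r) = {s ∈ R : sr = 0} is finitely generated. -/
/-- A commutative ring is arithmetic if for every maximal ideal `m` the ideals of the
localization `R_m` are totally ordered by inclusion. -/
def IsArithmeticRing (R : Type) [CommRing R] : Prop :=
  ∀ (m : Ideal R) [m.IsMaximal],
    ∀ I J : Ideal (Localization.AtPrime m), I ≤ J ∨ J ≤ I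


theorem aux_fp_iff (R : Type) [CommRing R] (M : Type) [AddCommGroup M] [Module R M] :
    IsFinNPresented R 1 M ↔ Module.FinitePresentation R M := by
  constructor
  · rintro ⟨k, f, g, hg, h0, -⟩
    refine Module.finitePresentation_of_surjective g hg ?_
    rw [h0 one_pos, LinearMap.range_eq_map]
    exact Module.Finite.fg_top.map _
  · intro h
    obtain ⟨n, m, f, g, hf, hfg⟩ := Module.FinitePresentation.exists_fin' R M
    refine ⟨fun i => Nat.casesOn i n (fun _ => m),
      fun i => Nat.casesOn i g (fun _ => 0), f, hf, fun _ => ?_, fun i hi => by omega⟩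
    exact LinearMap.exact_iff.mp hfg

theorem aux_local {R : Type} [CommRing R] (m : Ideal R) [m.IsMaximal] (J : Ideal R)
    (I : Ideal R) (hI : I.FG) :
    I.map (algebraMap R (Localization.AtPrime m)) ≤ J.map (algebraMap R (Localization.AtPrime m)) →
    ∃ s, s ∉ m ∧ ∀ x ∈ I, s * x ∈ J := by
  induction I, hI using Submodule.fg_induction with
  | singleton a =>
    intro h
    have h1 := h (Ideal.mem_map_of_mem _ (Submodule.mem_span_singleton_self a))
    rw [IsLocalization.algebraMap_mem_map_algebraMap_iff m.primeCompl] at h1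
    obtain ⟨s, hs, hsa⟩ := h1
    refine ⟨s, hs, fun x hx => ?_⟩
    obtain ⟨c, rfl⟩ := Submodule.mem_span_singleton.mp hx
    have := J.mul_mem_left c hsa
    rwa [smul_eq_mul, mul_left_comm]
  | sup A B hA hB ihA ihB =>
    intro h
    obtain ⟨s, hs, hs'⟩ := ihA ((Ideal.map_mono le_sup_left).trans h)
    obtain ⟨t, ht, ht'⟩ := ihB ((Ideal.map_mono le_sup_right).trans h)
    refine ⟨s * t, m.primeCompl.mul_mem hs ht, fun x hx => ?_⟩
    obtain ⟨a, ha, b, hb, rfl⟩ := Submodule.mem_sup.mp hx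
    have h1 := J.mul_mem_left t (hs' a ha)
    have h2 := J.mul_mem_left s (ht' b hb)
    have : s * t * (a + b) = t * (s * a) + s * (t * b) := by ring
    rw [this]
    exact J.add_mem h1 h2

theorem aux_comax {R : Type} [CommRing R] (hR : IsArithmeticRing R) (I J : Ideal R)
    (hI : I.FG) (hJ : J.FG) :
    ∃ s t : R, s + t = 1 ∧ (∀ x ∈ I, s * x ∈ J) ∧ (∀ x ∈ J, t * x ∈ I) := by
  have key : Submodule.colon J (I : Set R) ⊔ Submodule.colon I (J : Set R) = (⊤ : Ideal R) := by
    by_contra hne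
    obtain ⟨m, hm, hle⟩ := Ideal.exists_le_maximal _ hne
    rcases hR m (I.map (algebraMap R _)) (J.map (algebraMap R _)) with h | h
    · obtain ⟨s, hs, hs'⟩ := aux_local m J I hI h
      exact hs (hle (Ideal.mem_sup_left (Submodule.mem_colon.mpr hs')))
    · obtain ⟨s, hs, hs'⟩ := aux_local m I J hJ h
      exact hs (hle (Ideal.mem_sup_right (Submodule.mem_colon.mpr hs')))
  obtain ⟨s, hs, t, ht, h⟩ := Submodule.mem_sup.mp ((Ideal.eq_top_iff_one _).mp key)
  exact ⟨s, t, h, Submodule.mem_colon.mp hs, Submodule.mem_colon.mp ht⟩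

theorem aux_inf {R : Type} [CommRing R] (hR : IsArithmeticRing R) (I J : Ideal R)
    (hI : I.FG) (hJ : J.FG) : (I ⊓ J).FG := by
  obtain ⟨s, t, h, hs, ht⟩ := aux_comax hR I J hI hJ
  have : I ⊓ J = Submodule.map (LinearMap.mulLeft R s) I ⊔
      Submodule.map (LinearMap.mulLeft R t) J := by
    apply le_antisymm
    · rintro x ⟨hx1, hx2⟩
      refine Submodule.mem_sup.mpr ⟨s * x, ⟨x, hx1, rfl⟩, t * x, ⟨x, hx2, rfl⟩, ?_⟩
      rw [← add_mul, h, one_mul]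
    · refine sup_le ?_ ?_
      · rintro _ ⟨x, hx, rfl⟩
        exact ⟨I.mul_mem_left s hx, hs x hx⟩
      · rintro _ ⟨x, hx, rfl⟩
        exact ⟨ht x hx, J.mul_mem_left t hx⟩
  rw [this]
  exact Submodule.FG.sup (Submodule.FG.map _ hI) (Submodule.FG.map _ hJ)

theorem aux_sup {R : Type} [CommRing R] (I J : Ideal R) (hIJ : (I ⊓ J).FG)
    [Module.FinitePresentation R I] [Module.FinitePresentation R J] :
    Module.FinitePresentation R ↥(I ⊔ J) := by
  let l : (I × J) →ₗ[R] ↥(I ⊔ J) :=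
    LinearMap.coprod (Submodule.inclusion le_sup_left) (Submodule.inclusion le_sup_right)
  refine Module.finitePresentation_of_surjective l ?_ ?_
  · rintro ⟨x, hx⟩
    obtain ⟨a, ha, b, hb, rfl⟩ := Submodule.mem_sup.mp hx
    exact ⟨(⟨a, ha⟩, ⟨b, hb⟩), rfl⟩
  · let g : ↥(I ⊓ J) →ₗ[R] (I × J) :=
      LinearMap.prod (Submodule.inclusion inf_le_left) (-Submodule.inclusion inf_le_right)
    have : LinearMap.ker l = LinearMap.range g := by
      apply le_antisymm
      · rintro ⟨⟨a, ha⟩, ⟨b, hb⟩⟩ h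
        have h' : a + b = 0 := congrArg Subtype.val (LinearMap.mem_ker.mp h)
        have hab : a = -b := eq_neg_of_add_eq_zero_left h'
        refine ⟨⟨a, ha, hab ▸ J.neg_mem hb⟩, ?_⟩
        refine Prod.ext (Subtype.ext rfl) (Subtype.ext ?_)
        change -a = b
        rw [hab, neg_neg]
      · rintro _ ⟨⟨a, ha⟩, rfl⟩
        refine LinearMap.mem_ker.mpr (Subtype.ext ?_)
        change a + -a = 0
        exact add_neg_cancel a
    rw [this, LinearMap.range_eq_map]
    have : Module.Finite R ↥(I ⊓ J) := Module.Finite.iff_fg.mpr hIJ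
    exact Module.Finite.fg_top.map _

/-- A commutative arithmetic ring `R` is coherent if and only if the
annihilator `Ann(r) = {s : s * r = 0}` of every element `r` of `R` is a finitely
generated ideal. Here `Ann(r)` is the kernel of the map `R → R`, `s ↦ s * r`. -/
theorem arithmetic_coherent_iff_annihilator_fg
    (R : Type) [CommRing R] (hR : IsArithmeticRing R) :
    IsCoherentRing R ↔
      ∀ r : R, ∃ ann : Ideal R, (∀ s : R, s ∈ ann ↔ s * r = 0) ∧ ann.FG := by
  have hsurj : ∀ r : R, Function.Surjective (LinearMap.toSpanSingleton R R r).rangeRestrict :=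
    fun r => LinearMap.surjective_rangeRestrict _
  constructor
  · intro h r
    refine ⟨LinearMap.ker (LinearMap.toSpanSingleton R R r), fun s => by simp, ?_⟩
    have hfg : (LinearMap.range (LinearMap.toSpanSingleton R R r)).FG := by
      rw [LinearMap.range_eq_map]
      exact Module.Finite.fg_top.map _
    have := (aux_fp_iff R _).mp (h _ hfg)
    have h2 := Module.FinitePresentation.fg_ker _ (hsurj r)
    rwa [LinearMap.ker_rangeRestrict] at h2
  · intro h I hI
    rw [aux_fp_iff]
    induction I, hI using Submodule.fg_induction with
    | singleton r =>
      obtain ⟨ann, h1, h2⟩ := h r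
      have hk : ann = LinearMap.ker (LinearMap.toSpanSingleton R R r) := by
        ext s
        simp [h1]
      rw [hk, ← LinearMap.ker_rangeRestrict] at h2
      have := Module.finitePresentation_of_surjective _ (hsurj r) h2
      rwa [LinearMap.range_toSpanSingleton] at this
    | sup A B hA hB ihA ihB => exact aux_sup A B (aux_inf hR A B hA hB)
end

section
/- Every commutative arithmetic ring is strong 3-coherent: if R is a commutative ring such that for every maximal ideal 𝔪 the ideals of the localization R_𝔪 are totally ordered by inclusion, then every finitely 3-presented R-module is finitely 4-presented. -/
namespace ArithCoh

/-- Recursive version of finite `n`-presentation. -/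
def NP (R : Type) [CommRing R] : ℕ → ∀ (M : Type) [AddCommGroup M] [Module R M], Prop
  | 0, M, _, _ => Module.Finite R M
  | n + 1, M, _, _ => ∃ (k : ℕ) (g : (Fin k → R) →ₗ[R] M), Function.Surjective g ∧
      NP R n (LinearMap.ker g)

section basics
variable {R : Type} [CommRing R] {M N : Type} [AddCommGroup M] [Module R M]
  [AddCommGroup N] [Module R N]

theorem NP.equiv {n : ℕ} (e : M ≃ₗ[R] N) (h : NP R n M) : NP R n N := by
  cases n with
  | zero => exact
      have : Module.Finite R M := h
      Module.Finite.equiv e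
  | succ n =>
    obtain ⟨k, g, hg, hk⟩ := h
    refine ⟨k, e.toLinearMap ∘ₗ g, e.surjective.comp hg, ?_⟩
    rw [LinearEquiv.ker_comp]
    exact hk

theorem NP.finite {n : ℕ} (h : NP R n M) : Module.Finite R M := by
  cases n with
  | zero => exact h
  | succ n =>
    obtain ⟨k, g, hg, hk⟩ := h
    exact Module.Finite.of_surjective g hg

theorem NP.of_free_surj {n : ℕ} {F : Type} [AddCommGroup F] [Module R F] [Module.Free R F]
    [Module.Finite R F] (g : F →ₗ[R] M) (hg : Function.Surjective g)
    (h : NP R n (LinearMap.ker g)) : NP R (n + 1) M := by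
  obtain ⟨k, ⟨b⟩⟩ : ∃ k : ℕ, Nonempty (F ≃ₗ[R] (Fin k → R)) := by
    let b := Module.Free.chooseBasis R F
    let c := b.reindex (Fintype.equivFin _)
    exact ⟨_, ⟨c.equivFun⟩⟩
  refine ⟨k, g ∘ₗ b.symm.toLinearMap, hg.comp b.symm.surjective, ?_⟩
  refine h.equiv (LinearEquiv.ofSubmodule' b.symm (LinearMap.ker g)).symm

theorem NP.of_subsingleton [Subsingleton M] (n : ℕ) : NP R n M := by
  induction n generalizing M with
  | zero => exact Module.Finite.of_finite
  | succ n ih =>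
    exact ⟨0, 0, fun x => ⟨0, Subsingleton.elim _ _⟩, ih⟩

theorem NP.of_free [Module.Free R M] [Module.Finite R M] (n : ℕ) : NP R n M := by
  cases n with
  | zero => assumption
  | succ n =>
    refine NP.of_free_surj (LinearMap.id : M →ₗ[R] M) Function.surjective_id ?_
    have : Subsingleton (LinearMap.ker (LinearMap.id : M →ₗ[R] M)) := by
      rw [LinearMap.ker_id]; infer_instance
    exact NP.of_subsingleton n

theorem NP.mono {n : ℕ} (h : NP R (n + 1) M) : NP R n M := by
  induction n generalizing M with
  | zero => exact h.finite
  | succ n ih =>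
    obtain ⟨k, g, hg, hk⟩ := h
    exact ⟨k, g, hg, ih hk⟩

/-- kernel of a product map -/
noncomputable def kerProd {M' N' : Type} [AddCommGroup M'] [Module R M']
    [AddCommGroup N'] [Module R N'] (f : M →ₗ[R] M') (g : N →ₗ[R] N') :
    LinearMap.ker (f.prodMap g) ≃ₗ[R] LinearMap.ker f × LinearMap.ker g where
  toFun x := (⟨x.1.1, congrArg Prod.fst x.2⟩, ⟨x.1.2, congrArg Prod.snd x.2⟩)
  invFun x := ⟨(x.1.1, x.2.1), Prod.ext x.1.2 x.2.2⟩
  map_add' _ _ := rfl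
  map_smul' _ _ := rfl
  left_inv _ := rfl
  right_inv _ := rfl

theorem NP.prod {n : ℕ} (h : NP R n M) (h' : NP R n N) : NP R n (M × N) := by
  induction n generalizing M N with
  | zero =>
    have : Module.Finite R M := h
    have : Module.Finite R N := h'
    exact Module.Finite.prod
  | succ n ih =>
    obtain ⟨k, g, hg, hk⟩ := h
    obtain ⟨k', g', hg', hk'⟩ := h'
    exact NP.of_free_surj (g.prodMap g') (Prod.map_surjective.2 ⟨hg, hg'⟩)
      ((ih hk hk').equiv (kerProd g g').symm)

/-- Schanuel: the pullback -/
theorem schanuel_aux {F G : Type} [AddCommGroup F] [Module R F] [AddCommGroup G] [Module R G]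
    [Module.Projective R G] (f : F →ₗ[R] M) (g : G →ₗ[R] M) (hf : Function.Surjective f) :
    Nonempty ((LinearMap.ker (f.comp (LinearMap.fst R F G) - g.comp (LinearMap.snd R F G)))
      ≃ₗ[R] LinearMap.ker f × G) := by
  obtain ⟨s, hs⟩ := Module.projective_lifting_property f g hf
  have hs' : ∀ y, f (s y) = g y := fun y => LinearMap.congr_fun hs y
  exact ⟨{
    toFun := fun x => (⟨x.1.1 - s x.1.2, by
      have := x.2
      simp only [LinearMap.mem_ker, LinearMap.sub_apply, LinearMap.comp_apply,
        LinearMap.fst_apply, LinearMap.snd_apply] at this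
      rw [LinearMap.mem_ker, map_sub, hs', this]⟩, x.1.2)
    invFun := fun x => ⟨(x.1.1 + s x.2, x.2), by
      have := x.1.2
      rw [LinearMap.mem_ker] at this
      simp [hs', this]⟩
    map_add' := fun x y => by
      ext
      · simp; abel
      · simp
    map_smul' := fun r x => by
      ext
      · simp [smul_sub]
      · simp
    left_inv := fun x => by ext <;> simp
    right_inv := fun x => by ext <;> simp }⟩

theorem schanuel {F G : Type} [AddCommGroup F] [Module R F] [AddCommGroup G] [Module R G]
    [Module.Projective R G] [Module.Projective R F] (f : F →ₗ[R] M) (g : G →ₗ[R] M)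
    (hf : Function.Surjective f) (hg : Function.Surjective g) :
    Nonempty ((LinearMap.ker f × G) ≃ₗ[R] (LinearMap.ker g × F)) := by
  obtain ⟨e⟩ := schanuel_aux f g hf
  obtain ⟨e'⟩ := schanuel_aux g f hg
  suffices h : Submodule.comap (LinearEquiv.prodComm R G F).toLinearMap
      (LinearMap.ker (f.comp (LinearMap.fst R F G) - g.comp (LinearMap.snd R F G))) =
      LinearMap.ker (g.comp (LinearMap.fst R G F) - f.comp (LinearMap.snd R G F)) from
    ⟨e.symm.trans (((LinearEquiv.ofSubmodule' (LinearEquiv.prodComm R G F) _).symm.trans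
      (LinearEquiv.ofEq _ _ h)).trans e')⟩
  ext x
  simp only [Submodule.mem_comap, LinearMap.mem_ker, LinearMap.sub_apply, LinearMap.comp_apply,
    LinearMap.fst_apply, LinearMap.snd_apply, LinearEquiv.coe_coe, LinearEquiv.prodComm_apply,
    Prod.fst_swap, Prod.snd_swap]
  rw [sub_eq_zero, sub_eq_zero, eq_comm]

theorem NP.ker_aux {n : ℕ}
    (H : ∀ (M N : Type) [AddCommGroup M] [Module R M] [AddCommGroup N] [Module R N],
      NP R n (M × N) → NP R n M) (h : NP R (n + 1) M)
    {F : Type} [AddCommGroup F] [Module R F] [Module.Free R F]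
    [Module.Finite R F] (g : F →ₗ[R] M) (hg : Function.Surjective g) :
    NP R n (LinearMap.ker g) := by
  obtain ⟨k, f, hf, hk⟩ := h
  obtain ⟨e⟩ := schanuel f g hf hg
  exact H _ _ ((hk.prod (NP.of_free n)).equiv e)

theorem NP.fst {n : ℕ} (h : NP R n (M × N)) : NP R n M := by
  induction n generalizing M N with
  | zero =>
    have : Module.Finite R (M × N) := h
    exact Module.Finite.of_surjective (LinearMap.fst R M N) LinearMap.fst_surjective
  | succ n ih =>
    have : Module.Finite R (M × N) := h.finite
    have : Module.Finite R M :=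
      Module.Finite.of_surjective (LinearMap.fst R M N) LinearMap.fst_surjective
    have : Module.Finite R N :=
      Module.Finite.of_surjective (LinearMap.snd R M N) LinearMap.snd_surjective
    obtain ⟨a, f, hf⟩ := Module.Finite.exists_fin' R M
    obtain ⟨b, g, hg⟩ := Module.Finite.exists_fin' R N
    have := NP.ker_aux (fun M N _ _ _ _ h => ih h) h (f.prodMap g) (Prod.map_surjective.2 ⟨hf, hg⟩)
    exact ⟨a, f, hf, ih (this.equiv (kerProd f g))⟩

theorem NP.snd {n : ℕ} (h : NP R n (M × N)) : NP R n N :=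
  NP.fst (h.equiv (LinearEquiv.prodComm R M N))

theorem NP.ker {n : ℕ} (h : NP R (n + 1) M)
    {F : Type} [AddCommGroup F] [Module R F] [Module.Free R F]
    [Module.Finite R F] (g : F →ₗ[R] M) (hg : Function.Surjective g) :
    NP R n (LinearMap.ker g) :=
  NP.ker_aux (fun _ _ _ _ _ _ h => NP.fst h) h g hg

end basics

section transfer
variable {R : Type} [CommRing R]

theorem np_of {n : ℕ} {M : Type} [AddCommGroup M] [Module R M] (h : IsFinNPresented R n M) :
    NP R n M := by
  induction n generalizing M with
  | zero =>
    obtain ⟨k, f, g, hg, -⟩ := h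
    exact Module.Finite.of_surjective g hg
  | succ n ih =>
    obtain ⟨k, f, g, hg, h0, h1⟩ := h
    refine ⟨k 0, g, hg, ih ⟨fun i => k (i + 1), fun i => f (i + 1),
      (f 0).codRestrict _ (fun x => by rw [h0 n.succ_pos]; exact ⟨x, rfl⟩), ?_, ?_, ?_⟩⟩
    · rintro ⟨y, hy⟩
      rw [h0 n.succ_pos] at hy
      obtain ⟨x, rfl⟩ := hy
      exact ⟨x, rfl⟩
    · intro hn
      rw [LinearMap.ker_codRestrict]
      exact h1 0 (by omega)
    · intro i hi
      exact h1 (i + 1) (by omega)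

theorem of_np {n : ℕ} {M : Type} [AddCommGroup M] [Module R M] (h : NP R n M) :
    IsFinNPresented R n M := by
  induction n generalizing M with
  | zero =>
    have : Module.Finite R M := h
    obtain ⟨a, f, hf⟩ := Module.Finite.exists_fin' R M
    exact ⟨fun _ => a, fun _ => 0, f, hf, fun h => absurd h (lt_irrefl _),
      fun i hi => absurd hi (by omega)⟩
  | succ n ih =>
    obtain ⟨a, f, hf, hk⟩ := h
    obtain ⟨k, d, g, hg, h0, h1⟩ := ih hk
    refine ⟨fun i => Nat.casesOn i a k,
      fun i => Nat.casesOn i ((LinearMap.ker f).subtype ∘ₗ g) d, f, hf, ?_, ?_⟩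
    · intro _
      change LinearMap.ker f = LinearMap.range ((LinearMap.ker f).subtype ∘ₗ g)
      rw [LinearMap.range_comp, LinearMap.range_eq_top.2 hg, Submodule.map_top,
        Submodule.range_subtype]
    · intro i hi
      cases i with
      | zero =>
        change LinearMap.ker ((LinearMap.ker f).subtype ∘ₗ g) = LinearMap.range (d 0)
        rw [LinearMap.ker_comp_of_ker_eq_bot _ (Submodule.ker_subtype _)]
        exact h0 (by omega)
      | succ i => exact h1 i (by omega)

end transfer

section loc
variable {R : Type} [CommRing R]

/-- the standard localization map of a finite free module -/
noncomputable def piLoc (B : Type) [CommRing B] [Algebra R B] (k : ℕ) :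
    (Fin k → R) →ₗ[R] (Fin k → B) :=
  LinearMap.pi fun i => (Algebra.linearMap R B) ∘ₗ LinearMap.proj i

theorem piLoc_apply (B : Type) [CommRing B] [Algebra R B] (k : ℕ) (x : Fin k → R) (i : Fin k) :
    piLoc B k x i = algebraMap R B (x i) := rfl

instance piLoc_isLoc (S : Submonoid R) (B : Type) [CommRing B] [Algebra R B] [IsLocalization S B]
    (k : ℕ) : IsLocalizedModule S (piLoc (R := R) B k) :=
  IsLocalizedModule.pi S (fun _ : Fin k => Algebra.linearMap R B)

/-- localization of a presentation -/
noncomputable def locMap (S : Submonoid R) (B : Type) [CommRing B] [Algebra R B]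
    [IsLocalization S B] {M M' : Type} [AddCommGroup M] [Module R M] [AddCommGroup M'] [Module R M']
    [Module B M'] [IsScalarTower R B M'] (f : M →ₗ[R] M') [IsLocalizedModule S f] {k : ℕ}
    (g : (Fin k → R) →ₗ[R] M) : (Fin k → B) →ₗ[B] M' :=
  (IsLocalizedModule.map S (piLoc B k) f g).extendScalarsOfIsLocalization S B

section
variable (S : Submonoid R) (B : Type) [CommRing B] [Algebra R B]
    [IsLocalization S B] {M M' : Type} [AddCommGroup M] [Module R M] [AddCommGroup M'] [Module R M']
    [Module B M'] [IsScalarTower R B M'] (f : M →ₗ[R] M') [IsLocalizedModule S f] {k : ℕ}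
    (g : (Fin k → R) →ₗ[R] M)

theorem locMap_surj (hg : Function.Surjective g) : Function.Surjective (locMap S B f g) :=
  IsLocalizedModule.map_surjective S (piLoc B k) f g hg

theorem locMap_ker : (LinearMap.ker g).localized' B S (piLoc B k) =
    LinearMap.ker (locMap S B f g) :=
  LinearMap.localized'_ker_eq_ker_localizedMap B S (piLoc B k) f g

end

theorem NP.loc (S : Submonoid R) (B : Type) [CommRing B] [Algebra R B]
    [IsLocalization S B] {M M' : Type} [AddCommGroup M] [Module R M] [AddCommGroup M'] [Module R M']
    [Module B M'] [IsScalarTower R B M'] (f : M →ₗ[R] M') [IsLocalizedModule S f] {n : ℕ} (h : NP R n M) : NP B n M' := by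
  induction n generalizing M M' with
  | zero =>
    have : Module.Finite R M := h
    exact Module.Finite.of_isLocalizedModule S (Rₚ := B) f
  | succ n ih =>
    obtain ⟨k, g, hg, hk⟩ := h
    refine ⟨k, locMap S B f g, locMap_surj S B f g hg, ?_⟩
    rw [← locMap_ker S B f g]
    exact ih ((LinearMap.ker g).toLocalized' B S (piLoc B k)) hk

theorem NP.loc_congr (S : Submonoid R) (B : Type) [CommRing B] [Algebra R B]
    [IsLocalization S B] {M M' : Type} [AddCommGroup M] [Module R M] [AddCommGroup M'] [Module R M']
    [Module B M'] [IsScalarTower R B M'] (f : M →ₗ[R] M') [IsLocalizedModule S f] {n : ℕ} {M'' : Type} [AddCommGroup M''] [Module R M'']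
    [Module B M''] [IsScalarTower R B M''] (f' : M →ₗ[R] M'') [IsLocalizedModule S f']
    (h : NP B n M') : NP B n M'' :=
  h.equiv ((IsLocalizedModule.linearEquiv S f f').extendScalarsOfIsLocalization S B)

/-- local-global principle -/
theorem NP.of_local {n : ℕ} {M : Type} [AddCommGroup M] [Module R M]
    (h : ∀ p : Ideal R, p.IsMaximal → ∃ s, s ∉ p ∧
      NP (Localization.Away s) n (LocalizedModule.Away s M)) : NP R n M := by
  have key : ∀ {M : Type} [AddCommGroup M] [Module R M], (∀ p : Ideal R, p.IsMaximal → ∃ s, s ∉ p ∧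
      NP (Localization.Away s) 0 (LocalizedModule.Away s M)) → Module.Finite R M := by
    intro M _ _ h
    refine Module.Finite.of_localizationSpan
      {s | Module.Finite (Localization.Away s) (LocalizedModule.Away s M)} ?_ (fun g => g.2)
    by_contra hne
    obtain ⟨p, hp, hle⟩ := Ideal.exists_le_maximal _ hne
    obtain ⟨s, hs, hs'⟩ := h p hp
    exact hs (hle (Ideal.subset_span hs'))
  induction n generalizing M with
  | zero => exact key h
  | succ n ih =>
    have : Module.Finite R M := key fun p hp => by
      obtain ⟨s, hs, hs'⟩ := h p hp
      exact ⟨s, hs, hs'.finite⟩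
    obtain ⟨k, g, hg⟩ := Module.Finite.exists_fin' R M
    refine ⟨k, g, hg, ih fun p hp => ?_⟩
    obtain ⟨s, hs, hs'⟩ := h p hp
    refine ⟨s, hs, ?_⟩
    let f := LocalizedModule.mkLinearMap (Submonoid.powers s) M
    have h1 := hs'.ker (locMap (Submonoid.powers s) (Localization.Away s) f g)
      (locMap_surj _ _ f g hg)
    rw [← locMap_ker] at h1
    exact NP.loc_congr (Submonoid.powers s) (Localization.Away s)
      ((LinearMap.ker g).toLocalized' (Localization.Away s) (Submonoid.powers s)
        (piLoc (Localization.Away s) k))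
      (LocalizedModule.mkLinearMap (Submonoid.powers s) (LinearMap.ker g)) h1

end loc

section arith

/-- elementwise version of arithmeticity -/
def Arith (R : Type) [CommRing R] : Prop :=
  ∀ p : Ideal R, p.IsPrime → ∀ a b : R, ∃ s, s ∉ p ∧ (a ∣ s * b ∨ b ∣ s * a)

theorem arith_of {R : Type} [CommRing R] (hR : IsArithmeticRing R) : Arith R := by
  intro p hp a b
  obtain ⟨m, hm, hle⟩ := Ideal.exists_le_maximal p hp.ne_top
  suffices h : ∃ s, s ∉ m ∧ (a ∣ s * b ∨ b ∣ s * a) by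
    obtain ⟨s, hs, h⟩ := h
    exact ⟨s, fun h => hs (hle h), h⟩
  have key : ∀ a b : R, Ideal.span {algebraMap R (Localization.AtPrime m) b} ≤
      Ideal.span {algebraMap R (Localization.AtPrime m) a} → ∃ s, s ∉ m ∧ a ∣ s * b := by
    intro a b h
    rw [Ideal.span_singleton_le_span_singleton] at h
    obtain ⟨c, hc⟩ := h
    obtain ⟨⟨r, t⟩, hrt⟩ := IsLocalization.surj m.primeCompl c
    have : algebraMap R (Localization.AtPrime m) (t * b) = algebraMap R _ (a * r) := by
      simp only at hrt
      rw [map_mul, map_mul, hc, ← hrt]; ring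
    obtain ⟨u, hu⟩ := (IsLocalization.eq_iff_exists m.primeCompl _).1 this
    refine ⟨u * t, (u * t).2, u * r, ?_⟩
    rw [mul_assoc, hu]; ring
  rcases hR m (Ideal.span {algebraMap R (Localization.AtPrime m) a})
    (Ideal.span {algebraMap R (Localization.AtPrime m) b}) with h | h
  · obtain ⟨s, hs, h⟩ := key _ _ h
    exact ⟨s, hs, Or.inr h⟩
  · obtain ⟨s, hs, h⟩ := key _ _ h
    exact ⟨s, hs, Or.inl h⟩

theorem Arith.loc {R : Type} [CommRing R] (hR : Arith R) (S : Submonoid R) (B : Type) [CommRing B]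
    [Algebra R B] [IsLocalization S B] : Arith B := by
  intro p hp a b
  obtain ⟨⟨r, t⟩, hrt⟩ := IsLocalization.surj S a
  obtain ⟨⟨r', t'⟩, hrt'⟩ := IsLocalization.surj S b
  simp only at hrt hrt'
  have ht := IsLocalization.map_units B t
  have ht' := IsLocalization.map_units B t'
  obtain ⟨s, hs, h⟩ := hR (p.comap (algebraMap R B)) inferInstance r r'
  refine ⟨algebraMap R B s, hs, ?_⟩
  have h' := Or.imp (map_dvd (algebraMap R B)) (map_dvd (algebraMap R B)) h
  rw [map_mul, map_mul, ← hrt, ← hrt', ← mul_assoc, ← mul_assoc] at h'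
  simpa [ht.dvd_mul_right, ht'.dvd_mul_right, ht.mul_right_dvd, ht'.mul_right_dvd] using h'

/-- locally, some member of a finite family divides all the others -/
theorem Arith.pivot {R : Type} [CommRing R] (hR : Arith R) (p : Ideal R) (hp : p.IsPrime)
    {ι : Type} [Finite ι] [Nonempty ι] (x : ι → R) :
    ∃ s, s ∉ p ∧ ∃ i, ∀ j, x i ∣ s * x j := by
  classical
  suffices h : ∀ t : Finset ι, t.Nonempty → ∃ s, s ∉ p ∧ ∃ i, ∀ j ∈ t, x i ∣ s * x j by
    have := Fintype.ofFinite ι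
    obtain ⟨s, hs, i, h⟩ := h Finset.univ Finset.univ_nonempty
    exact ⟨s, hs, i, fun j => h j (Finset.mem_univ j)⟩
  intro t ht
  induction ht using Finset.Nonempty.cons_induction with
  | singleton a =>
    exact ⟨1, fun h => hp.ne_top ((Ideal.eq_top_iff_one p).2 h), a, by simp⟩
  | cons a t ha ht ih =>
    obtain ⟨s, hs, i, h⟩ := ih
    obtain ⟨u, hu, h'⟩ := hR p hp (x a) (x i)
    have hsu : s * u ∉ p := fun h => (hp.mem_or_mem h).elim hs hu
    refine ⟨s * u, hsu, ?_⟩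
    rcases h' with h' | h'
    · refine ⟨a, fun j hj => ?_⟩
      rcases Finset.mem_cons.1 hj with rfl | hj
      · exact Dvd.intro_left _ rfl
      · obtain ⟨c, hc⟩ := h j hj
        have : s * u * x j = c * (u * x i) := by linear_combination u * hc
        rw [this]
        exact h'.mul_left c
    · refine ⟨i, fun j hj => ?_⟩
      rcases Finset.mem_cons.1 hj with rfl | hj
      · rw [mul_assoc]; exact h'.mul_left s
      · rw [mul_comm s u, mul_assoc]; exact (h j hj).mul_left u

end arith

section cyclic
variable {R : Type} [CommRing R]

/-- annihilator of an element -/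
def A (a : R) : Submodule R R := LinearMap.ker (LinearMap.toSpanSingleton R R a)

theorem mem_A {a x : R} : x ∈ A a ↔ x * a = 0 := by
  simp [A, LinearMap.mem_ker]

theorem np_span_iff (a : R) (n : ℕ) : NP R (n + 1) (Ideal.span {a}) ↔ NP R n (A a) := by
  let f := LinearMap.toSpanSingleton R R a
  have e : LinearMap.range f = Ideal.span {a} := LinearMap.range_toSpanSingleton a
  rw [← e]
  have hs : Function.Surjective f.rangeRestrict := f.surjective_rangeRestrict
  have hk : LinearMap.ker f.rangeRestrict = A a := f.ker_rangeRestrict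
  constructor
  · intro h
    have := h.ker f.rangeRestrict hs
    rwa [hk] at this
  · intro h
    exact NP.of_free_surj f.rangeRestrict hs (by rwa [hk])

theorem np_quot_iff (I : Ideal R) (n : ℕ) : NP R (n + 1) (R ⧸ I) ↔ NP R n I := by
  have hs : Function.Surjective (Submodule.mkQ I) := Submodule.mkQ_surjective I
  have hk : LinearMap.ker (Submodule.mkQ I) = I := Submodule.ker_mkQ I
  constructor
  · intro h
    have := h.ker (Submodule.mkQ I) hs
    rwa [hk] at this
  · intro h
    exact NP.of_free_surj (Submodule.mkQ I) hs (by rwa [hk])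

theorem cyc_aux {a b c : R} (hb : A a = Ideal.span {b}) (hc : A b = Ideal.span {c}) :
    NP R 4 (R ⧸ Ideal.span {a}) := by
  have hcb : A c = Ideal.span {b} := by
    rw [← hb]
    have h1 : b * a = 0 := by
      rw [← mem_A, hb]; exact Ideal.mem_span_singleton_self b
    have h2 : c * b = 0 := by
      rw [← mem_A, hc]; exact Ideal.mem_span_singleton_self c
    have h3 : a ∈ Ideal.span {c} := by
      rw [← hc, mem_A, mul_comm, h1]
    obtain ⟨d, hd⟩ := Ideal.mem_span_singleton.1 h3
    apply le_antisymm
    · intro y hy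
      rw [mem_A] at hy ⊢
      rw [hd, ← mul_assoc, hy, zero_mul]
    · intro y hy
      rw [hb] at hy
      obtain ⟨e, he⟩ := Ideal.mem_span_singleton.1 hy
      rw [mem_A, he]
      linear_combination e * h2
  rw [np_quot_iff, np_span_iff, hb, np_span_iff, hc, np_span_iff, hcb]
  exact ⟨⟨{⟨b, Ideal.mem_span_singleton_self b⟩}, by
    rw [eq_top_iff]
    rintro ⟨x, hx⟩ -
    obtain ⟨e, he⟩ := Ideal.mem_span_singleton.1 hx
    rw [Finset.coe_singleton, Submodule.mem_span_singleton]
    exact ⟨e, Subtype.ext (by simp [he, mul_comm])⟩⟩⟩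

theorem A_loc (S : Submonoid R) (B : Type) [CommRing B] [Algebra R B] [IsLocalization S B]
    {a b s : R} (hs : s ∈ S) (hb : b ∈ A a) (h : ∀ x ∈ A a, b ∣ s * x) :
    A (algebraMap R B a) = Ideal.span {algebraMap R B b} := by
  apply le_antisymm
  · intro y hy
    rw [mem_A] at hy
    obtain ⟨⟨r, t⟩, hrt⟩ := IsLocalization.surj S y
    simp only at hrt
    have h1 : algebraMap R B (r * a) = algebraMap R B 0 := by
      rw [map_mul, ← hrt, map_zero]
      linear_combination algebraMap R B t * hy
    obtain ⟨u, hu⟩ := (IsLocalization.eq_iff_exists S B).1 h1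
    have h2 := map_dvd (algebraMap R B) (h (u * r) (by rw [mem_A]; linear_combination hu))
    rw [map_mul, map_mul, ← hrt] at h2
    have hs' := IsLocalization.map_units B (⟨s, hs⟩ : S)
    have hu' := IsLocalization.map_units B u
    have ht' := IsLocalization.map_units B t
    rw [Ideal.mem_span_singleton]
    rwa [hs'.dvd_mul_left, hu'.dvd_mul_left, ht'.dvd_mul_right] at h2
  · rw [Ideal.span_singleton_le_iff_mem, mem_A, ← map_mul, mem_A.1 hb, map_zero]

theorem np_quot_loc (S : Submonoid R) (B : Type) [CommRing B] [Algebra R B] [IsLocalization S B]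
    {M' : Type} [AddCommGroup M'] [Module R M'] [Module B M'] [IsScalarTower R B M'] (a : R)
    (f : (R ⧸ Ideal.span {a}) →ₗ[R] M') [IsLocalizedModule S f] (n : ℕ) :
    NP B n M' ↔ NP B n (B ⧸ Ideal.span {algebraMap R B a}) := by
  have e : Submodule.localized' B S (Algebra.linearMap R B) (Ideal.span {a}) =
      Ideal.span {algebraMap R B a} := by
    rw [Ideal.span, Submodule.localized'_span]
    simp [Ideal.span]
  rw [← e]
  let q := Submodule.toLocalizedQuotient' B S (Algebra.linearMap R B) (Ideal.span {a})
  exact ⟨fun h => NP.loc_congr S B f q h, fun h => NP.loc_congr S B q f h⟩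

theorem fg_pivot (hR : Arith R) (p : Ideal R) (hp : p.IsPrime) {I : Submodule R R}
    (hI : Module.Finite R I) : ∃ s, s ∉ p ∧ ∃ b ∈ I, ∀ x ∈ I, b ∣ s * x := by
  obtain ⟨n, y, hy⟩ := Submodule.fg_iff_exists_fin_generating_family.1 (Module.Finite.iff_fg.1 hI)
  let z : Option (Fin n) → R := fun o => o.elim 0 y
  obtain ⟨s, hs, i, h⟩ := hR.pivot p hp z
  refine ⟨s, hs, z i, ?_, ?_⟩
  · cases i with
    | none => exact I.zero_mem
    | some i => rw [← hy]; exact Submodule.subset_span ⟨i, rfl⟩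
  · intro x hx
    rw [← hy] at hx
    induction hx using Submodule.span_induction with
    | mem x hx => obtain ⟨j, rfl⟩ := hx; exact h (some j)
    | zero => simp
    | add x y _ _ hx hy => rw [mul_add]; exact dvd_add hx hy
    | smul r x _ hx => rw [smul_eq_mul, mul_left_comm]; exact hx.mul_left r

theorem cyc0 (hR : Arith R) {a b : R} (hb : A a = Ideal.span {b})
    (h : NP R 3 (R ⧸ Ideal.span {a})) : NP R 4 (R ⧸ Ideal.span {a}) := by
  rw [np_quot_iff, np_span_iff, hb, np_span_iff] at h
  refine NP.of_local fun p hp => ?_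
  obtain ⟨s, hs, c, hc, hcx⟩ := fg_pivot hR p hp.isPrime h
  refine ⟨s, hs, ?_⟩
  rw [np_quot_loc (Submonoid.powers s) (Localization.Away s) a
    (LocalizedModule.mkLinearMap (Submonoid.powers s) _)]
  refine cyc_aux (b := algebraMap R _ b) (c := algebraMap R _ c)
    (A_loc (Submonoid.powers s) _ (Submonoid.mem_powers s) ?_ ?_)
    (A_loc (Submonoid.powers s) _ (Submonoid.mem_powers s) hc hcx)
  · rw [hb]; exact Ideal.mem_span_singleton_self b
  · intro x hx
    rw [hb, Ideal.mem_span_singleton] at hx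
    exact hx.mul_left s

theorem cyc (hR : Arith R) {a : R}
    (h : NP R 3 (R ⧸ Ideal.span {a})) : NP R 4 (R ⧸ Ideal.span {a}) := by
  have h' := h
  rw [np_quot_iff, np_span_iff] at h'
  refine NP.of_local fun p hp => ?_
  obtain ⟨s, hs, b, hb, hbx⟩ := fg_pivot hR p hp.isPrime h'.finite
  refine ⟨s, hs, ?_⟩
  let f := LocalizedModule.mkLinearMap (Submonoid.powers s) (R ⧸ Ideal.span {a})
  rw [np_quot_loc (Submonoid.powers s) (Localization.Away s) a f]
  refine cyc0 (hR.loc (Submonoid.powers s) _) (b := algebraMap R _ b)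
    (A_loc (Submonoid.powers s) _ (Submonoid.mem_powers s) hb hbx) ?_
  rw [← np_quot_loc (Submonoid.powers s) (Localization.Away s) a f]
  exact h.loc (Submonoid.powers s) _ f

end cyclic

section main
variable {R : Type} [CommRing R]

theorem split {M : Type} [AddCommGroup M] [Module R M] {k : ℕ} (g : (Fin (k + 1) → R) →ₗ[R] M)
    (hg : Function.Surjective g) (v : Fin (k + 1) → R) (hv : g v = 0) (i : Fin (k + 1))
    (h : ∀ y, g y = 0 → ∀ j, v i ∣ y j) :
    ∃ K : Submodule R (Fin k → R),
      Nonempty (M ≃ₗ[R] (R ⧸ Ideal.span {v i}) × ((Fin k → R) ⧸ K)) := by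
  obtain ⟨w, hwi, hw⟩ : ∃ w : Fin (k + 1) → R, w i = 1 ∧ ∀ j, v j = v i * w j := by
    choose w hw using h v hv
    refine ⟨Function.update w i 1, by simp, fun j => ?_⟩
    by_cases hj : j = i
    · subst hj; simp
    · rw [Function.update_of_ne hj]; exact hw j
  let φ : (Fin (k + 1) → R) →ₗ[R] (Fin k → R) :=
    { toFun := fun x j => x (i.succAbove j) - x i * w (i.succAbove j)
      map_add' := fun x y => by ext j; simp; ring
      map_smul' := fun r x => by ext j; simp; ring }
  have hφ : ∀ x j, φ x j = x (i.succAbove j) - x i * w (i.succAbove j) := fun _ _ => rfl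
  have hφv : φ v = 0 := by
    ext j; rw [hφ, hw (i.succAbove j)]; simp
  have hφ0 : ∀ u, u i = 0 → φ u = 0 → u = 0 := by
    intro u hu hu'
    ext j
    rcases Fin.eq_self_or_eq_succAbove i j with rfl | ⟨j, rfl⟩
    · exact hu
    · have := congrFun hu' j
      rw [hφ, hu] at this
      simpa using this
  let K := (LinearMap.ker g).map φ
  refine ⟨K, ?_⟩
  let Ψ : (Fin (k + 1) → R) →ₗ[R] (R ⧸ Ideal.span {v i}) × ((Fin k → R) ⧸ K) :=
    LinearMap.prod ((Submodule.mkQ (Ideal.span {v i})) ∘ₗ LinearMap.proj i) (K.mkQ ∘ₗ φ)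
  have hΨ : Function.Surjective Ψ := by
    rintro ⟨r, y⟩
    obtain ⟨r, rfl⟩ := Submodule.mkQ_surjective _ r
    obtain ⟨y, rfl⟩ := Submodule.mkQ_surjective _ y
    let x : Fin (k + 1) → R := r • w + i.insertNth (α := fun _ => R) 0 y
    have hx : x i = r := by simp [x, hwi]
    have hx' : φ x = y := by
      ext j
      rw [hφ, hx]
      simp [x]
    refine ⟨x, Prod.ext ?_ ?_⟩
    · change Submodule.mkQ _ (x i) = _
      rw [hx]
    · change Submodule.mkQ _ (φ x) = _
      rw [hx']
  have hker : LinearMap.ker g = LinearMap.ker Ψ := by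
    ext x
    have : x ∈ LinearMap.ker Ψ ↔ v i ∣ x i ∧ φ x ∈ K := by
      rw [LinearMap.mem_ker, Prod.ext_iff, ← Ideal.mem_span_singleton]
      refine and_congr (Submodule.Quotient.mk_eq_zero _) (Submodule.Quotient.mk_eq_zero _)
    rw [this]
    constructor
    · intro hx
      exact ⟨h x hx i, ⟨x, hx, rfl⟩⟩
    · rintro ⟨⟨c, hc⟩, z, hz, hzx⟩
      obtain ⟨d, hd⟩ := h z hz i
      have : x - c • v - (z - d • v) = 0 := by
        apply hφ0
        · simp [hc, hd]; ring
        · simp [hφv, hzx]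
      have h2 : x = c • v + (z - d • v) := by
        rw [sub_eq_zero, sub_eq_iff_eq_add] at this
        rw [this]; abel
      have hz' : g z = 0 := hz
      rw [LinearMap.mem_ker, h2]
      simp [hv, hz']
  exact ⟨(g.quotKerEquivOfSurjective hg).symm.trans
    ((Submodule.quotEquivOfEq _ _ hker).trans (Ψ.quotKerEquivOfSurjective hΨ))⟩

theorem main_aux (k : ℕ) : ∀ (R : Type) [CommRing R], Arith R →
    ∀ (M : Type) [AddCommGroup M] [Module R M] (g : (Fin k → R) →ₗ[R] M),
      Function.Surjective g → NP R 3 M → NP R 4 M := by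
  induction k with
  | zero =>
    intro R _ hR M _ _ g hg h
    have : Subsingleton M := hg.subsingleton
    exact NP.of_subsingleton 4
  | succ k ih =>
    intro R _ hR M _ _ g hg h
    refine NP.of_local fun p hp => ?_
    have hfin := (h.ker g hg).finite
    obtain ⟨n, y, hy⟩ :=
      Submodule.fg_iff_exists_fin_generating_family.1 (Module.Finite.iff_fg.1 hfin)
    let z : Option (Fin n) → Fin (k + 1) → R := fun o => o.elim 0 y
    obtain ⟨s, hs, ⟨l, i⟩, hz⟩ := hR.pivot p hp.isPrime
      (fun q : Option (Fin n) × Fin (k + 1) => z q.1 q.2)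
    have hz1 : g (z l) = 0 := by
      cases l with
      | none => exact map_zero g
      | some l =>
        have : y l ∈ LinearMap.ker g := by rw [← hy]; exact Submodule.subset_span ⟨l, rfl⟩
        exact this
    have hz2 : ∀ x ∈ LinearMap.ker g, ∀ j, z l i ∣ s * x j := by
      intro x hx j
      rw [← hy] at hx
      induction hx using Submodule.span_induction with
      | mem x hx => obtain ⟨m, rfl⟩ := hx; exact hz (some m, j)
      | zero => simp
      | add x y _ _ hx hy => rw [Pi.add_apply, mul_add]; exact dvd_add hx hy
      | smul r x _ hx =>
        rw [Pi.smul_apply, smul_eq_mul, mul_left_comm]; exact hx.mul_left r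
    refine ⟨s, hs, ?_⟩
    let S := Submonoid.powers s
    let B := Localization.Away s
    let f := LocalizedModule.mkLinearMap S M
    have hB : Arith B := hR.loc S B
    have h3 : NP B 3 (LocalizedModule.Away s M) := h.loc S B f
    let G := locMap S B f g
    have hG : Function.Surjective G := locMap_surj S B f g hg
    have hGv : G (piLoc B (k + 1) (z l)) = 0 := by
      change IsLocalizedModule.map S (piLoc B (k + 1)) f g (piLoc B (k + 1) (z l)) = 0
      rw [IsLocalizedModule.map_apply, hz1, map_zero]
    obtain ⟨K, ⟨e⟩⟩ := split G hG (piLoc B (k + 1) (z l)) hGv i (by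
      intro y' hy' j
      have hy2 : y' ∈ LinearMap.ker G := hy'
      rw [← locMap_ker S B f g] at hy2
      obtain ⟨m, hm, t, rfl⟩ := hy2
      have h1 : algebraMap R B t * (IsLocalizedModule.mk' (piLoc B (k + 1)) m t) j =
          algebraMap R B (m j) := by
        have := congrFun (IsLocalizedModule.mk'_cancel' (piLoc B (k + 1)) m t) j
        rw [piLoc_apply] at this
        rw [← this, Pi.smul_apply, Submonoid.smul_def, Algebra.smul_def]
      have h2 := map_dvd (algebraMap R B) (hz2 m hm j)
      rw [map_mul, ← h1] at h2
      have hs' := IsLocalization.map_units B (⟨s, Submonoid.mem_powers s⟩ : S)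
      have ht' := IsLocalization.map_units B t
      rw [hs'.dvd_mul_left, ht'.dvd_mul_left] at h2
      exact h2)
    have h3' := h3.equiv e
    exact ((cyc hB h3'.fst).prod (ih B hB _ K.mkQ (Submodule.mkQ_surjective K) h3'.snd)).equiv e.symm

end main

end ArithCoh

/-- Every commutative arithmetic ring is strong `3`-coherent: every
finitely `3`-presented module is finitely `4`-presented. -/
theorem arithmetic_strong_three_coherent
    (R : Type) [CommRing R] (hR : IsArithmeticRing R) :
    StrongNCoherent R 3 := by
  intro M _ _ h
  have h3 := ArithCoh.np_of h
  have := h3.finite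
  obtain ⟨k, g, hg⟩ := Module.Finite.exists_fin' R M
  exact ArithCoh.of_np (ArithCoh.main_aux k R (ArithCoh.arith_of hR) M g hg h3)
end
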